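/- arXiv:1908.00869 — 2 statements merged into one kernel-verified Lean document; each statement's English description precedes it below -/
import Mathlib

section
/- There exists a Borel probability measure μ on ℝ^N × ℝ^N such that ∫ L dμ = 0 and ∫ Φ dμ ≥ 0 for every continuous Φ : ℝ^N × ℝ^N → ℝ that is bounded from below and admits a subsolution; in other words, Mather measures for the ergodic equation exist. -/
open MeasureTheory Set
open scoped RealInnerProductSpace

noncomputable section

abbrev Euc (N : ℕ) := EuclideanSpace ℝ (Fin N)

/-- `u` is an (a.e.) subsolution of `H = a` in `ℝ^N`. -/
def IsSubsol {N : ℕ} (H : Euc N × Euc N → ℝ) (a : ℝ) (u : Euc N → ℝ) : Prop :=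
  LocallyLipschitz u ∧
    ∀ᵐ x : Euc N ∂volume, DifferentiableAt ℝ u x → H (x, gradient u x) ≤ a

/-- `u` is an (a.e.) subsolution of the discounted equation `λ u + H(x,Du) = 0`. -/
def IsDiscSubsol {N : ℕ} (H : Euc N × Euc N → ℝ) (lam : ℝ) (u : Euc N → ℝ) : Prop :=
  LocallyLipschitz u ∧
    ∀ᵐ x : Euc N ∂volume, DifferentiableAt ℝ u x →
      lam * u x + H (x, gradient u x) ≤ 0

/-- The Lagrangian associated with `H` via the Fenchel transform. -/
def Lag {N : ℕ} (H : Euc N × Euc N → ℝ) : Euc N × Euc N → ℝ :=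
  fun z => sSup (Set.range fun p : Euc N => ⟪p, z.2⟫ - H (z.1, p))

/-- `u` is a subsolution for the generalized Lagrangian `Φ`. -/
def SubsolFor {N : ℕ} (Φ : Euc N × Euc N → ℝ) (u : Euc N → ℝ) : Prop :=
  LocallyLipschitz u ∧
    ∀ᵐ x : Euc N ∂volume, DifferentiableAt ℝ u x →
      ∀ q : Euc N, fderiv ℝ u x q ≤ Φ (x, q)

/-- `u` is a `λ`-discounted subsolution for the generalized Lagrangian `Φ`. -/
def DiscSubsolFor {N : ℕ} (lam : ℝ) (Φ : Euc N × Euc N → ℝ) (u : Euc N → ℝ) : Prop :=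
  LocallyLipschitz u ∧
    ∀ᵐ x : Euc N ∂volume, DifferentiableAt ℝ u x →
      ∀ q : Euc N, lam * u x + fderiv ℝ u x q ≤ Φ (x, q)

/-- A Mather measure for the ergodic problem. -/
def MatherMeasure {N : ℕ} (H : Euc N × Euc N → ℝ) (μ : Measure (Euc N × Euc N)) : Prop :=
  IsProbabilityMeasure μ ∧ Integrable (Lag H) μ ∧ (∫ z, Lag H z ∂μ) = 0 ∧
    ∀ Φ : Euc N × Euc N → ℝ, Continuous Φ → BddBelow (Set.range Φ) →
      (∃ u, SubsolFor Φ u) → (Integrable Φ μ → 0 ≤ ∫ z, Φ z ∂μ)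

/-- A `(λ,z)`-Mather measure (relative to the maximal discounted solution `um`). -/
def DiscMatherMeasure {N : ℕ} (H : Euc N × Euc N → ℝ) (lam : ℝ) (z : Euc N)
    (um : Euc N → ℝ) (μ : Measure (Euc N × Euc N)) : Prop :=
  IsProbabilityMeasure μ ∧ Integrable (Lag H) μ ∧ (∫ w, Lag H w ∂μ) = lam * um z ∧
    ∀ Φ : Euc N × Euc N → ℝ, Continuous Φ → BddBelow (Set.range Φ) →
      ∀ u : Euc N → ℝ, DiscSubsolFor lam Φ u →
        (Integrable Φ μ → lam * u z ≤ ∫ w, Φ w ∂μ)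

lemma LocallyLipschitz.exists_lipschitzWith_eqOn_closedBall {E : Type*} [NormedAddCommGroup E]
    [ProperSpace E] {u : E → ℝ} (hu : LocallyLipschitz u) (R : ℝ) :
    ∃ (K : NNReal) (w : E → ℝ), LipschitzWith K w ∧ EqOn u w (Metric.closedBall 0 R) := by
  obtain ⟨K, hK⟩ := (hu.locallyLipschitzOn (s := Metric.closedBall 0 R)
    ).exists_lipschitzOnWith_of_compact (isCompact_closedBall _ _)
  obtain ⟨w, hw, heq⟩ := hK.extend_real
  exact ⟨K, w, hw, heq⟩

/-- Rademacher's theorem for locally Lipschitz functions. -/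
lemma LocallyLipschitz.ae_differentiableAt {N : ℕ} {u : Euc N → ℝ} (hu : LocallyLipschitz u) :
    ∀ᵐ x, DifferentiableAt ℝ u x := by
  choose K w hw heq using fun n : ℕ => hu.exists_lipschitzWith_eqOn_closedBall (n : ℝ)
  filter_upwards [ae_all_iff.2 fun n => (hw n).ae_differentiableAt (μ := volume)] with x hx
  obtain ⟨n, hn⟩ := exists_nat_gt ‖x‖
  refine (hx n).congr_of_eventuallyEq ?_
  filter_upwards [Metric.isOpen_ball.mem_nhds (mem_ball_zero_iff.2 hn)] with y hy
  exact heq n (Metric.ball_subset_closedBall hy)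

/-- A continuous convex function on a Hilbert space has a subgradient at
every point. -/
lemma exists_subgradient {E : Type*} [NormedAddCommGroup E] [InnerProductSpace ℝ E]
    [CompleteSpace E] {f : E → ℝ} (hconv : ConvexOn ℝ univ f) (hcont : Continuous f) (p : E) :
    ∃ q : E, ∀ p', f p + ⟪q, p' - p⟫ ≤ f p' := by
  have hopen : IsOpen {z : E × ℝ | f z.1 < z.2} :=
    isOpen_lt (hcont.comp continuous_fst) continuous_snd
  have hcvx : Convex ℝ {z : E × ℝ | f z.1 < z.2} := by
    simpa using hconv.convex_strict_epigraph
  obtain ⟨g, hg⟩ := geometric_hahn_banach_open_point (x := (p, f p)) hcvx hopen (by simp)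
  set g₁ : StrongDual ℝ E := g.comp (ContinuousLinearMap.inl ℝ E ℝ) with hg₁
  set b : ℝ := g (0, 1) with hb
  have hsplit : ∀ (x : E) (t : ℝ), g (x, t) = g₁ x + t * b := by
    intro x t
    have : ((x, t) : E × ℝ) = (x, 0) + t • (0, 1) := by ext <;> simp
    rw [this, map_add, map_smul]; simp [hg₁, hb]
  have hlt : ∀ (x : E) (t : ℝ), f x < t → g₁ x + t * b < g₁ p + f p * b := by
    intro x t h
    have := hg (x, t) h
    rwa [hsplit, hsplit] at this
  have hb0 : b < 0 := by have := hlt p (f p + 1) (by linarith); linarith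
  have hle : ∀ x : E, g₁ x + f x * b ≤ g₁ p + f p * b := by
    intro x
    refine le_of_forall_pos_le_add fun e he => ?_
    have := hlt x (f x + e / (-b)) (by
      have : 0 < e / (-b) := by apply div_pos he; linarith
      linarith)
    have h2 : e / (-b) * b = -e := by
      have := hb0.ne; field_simp
    rw [add_mul, h2] at this
    linarith
  refine ⟨(InnerProductSpace.toDual ℝ E).symm ((-b)⁻¹ • g₁), fun p' => ?_⟩
  rw [InnerProductSpace.toDual_symm_apply]
  have h := hle p'
  have hpos : 0 < (-b)⁻¹ := by rw [inv_pos]; linarith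
  have h3 := mul_le_mul_of_nonneg_left h hpos.le
  have h4 : (-b)⁻¹ * b = -1 := by rw [inv_neg, neg_mul, inv_mul_cancel₀ hb0.ne]
  simp only [smul_apply, map_sub, smul_eq_mul]
  have e1 : (-b)⁻¹ * (g₁ p' + f p' * b) = (-b)⁻¹ * g₁ p' - f p' := by linear_combination f p' * h4
  have e2 : (-b)⁻¹ * (g₁ p + f p * b) = (-b)⁻¹ * g₁ p - f p := by linear_combination f p * h4
  rw [e1, e2] at h3
  linarith

section Lagrangian

variable {N : ℕ} {H : Euc N × Euc N → ℝ}

/-- Pointwise superlinearity of a continuous Hamiltonian which is convex in the momentum is locally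
uniform in the position. -/
lemma exists_eventually_linear_growth (hA1 : Continuous H)
    (hconv : ∀ x : Euc N, ConvexOn ℝ Set.univ fun p => H (x, p))
    (hsl : ∀ x : Euc N, ∀ C : ℝ, ∃ r : ℝ, ∀ p : Euc N, r ≤ ‖p‖ → C * ‖p‖ ≤ H (x, p))
    (x₀ : Euc N) (C : ℝ) :
    ∃ r > (0 : ℝ), ∀ᶠ x in nhds x₀, ∀ p, r ≤ ‖p‖ → H (x, 0) + C * ‖p‖ ≤ H (x, p) := by
  obtain ⟨r₀, hr₀⟩ := hsl x₀ (C + 1)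
  set r : ℝ := max r₀ 1 + |H (x₀, 0)| with hr
  have hr1 : 1 ≤ r := by
    have := le_max_right r₀ 1; have := abs_nonneg (H (x₀, 0)); linarith
  have hrH : H (x₀, 0) + 1 ≤ r := by
    have := le_max_right r₀ 1; have := le_abs_self (H (x₀, 0)); linarith
  have hrr₀ : r₀ ≤ r := by
    have := le_max_left r₀ 1; have := abs_nonneg (H (x₀, 0)); linarith
  have hev : ∀ᶠ x in nhds x₀, ∀ p ∈ Metric.sphere (0 : Euc N) r,
      H (x, 0) + C * r < H (x, p) := by
    refine (isCompact_sphere _ _).eventually_forall_of_forall_eventually fun p hp => ?_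
    refine (isOpen_lt (f := fun z : Euc N × Euc N => H (z.1, 0) + C * r) (g := fun z => H z)
      (by fun_prop) hA1).mem_nhds ?_
    have hpn : ‖p‖ = r := by simpa using hp
    have := hr₀ p (by rw [hpn]; exact hrr₀)
    rw [hpn] at this
    simp only [mem_ofPred_eq]
    linarith
  refine ⟨r, by linarith, hev.mono fun x hx p hp => ?_⟩
  have hp0 : 0 < ‖p‖ := by linarith
  have hs0 : 0 < r / ‖p‖ := by positivity
  have hs1 : r / ‖p‖ ≤ 1 := by rwa [div_le_one hp0]
  have h1 := hx ((r / ‖p‖) • p) (by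
    rw [mem_sphere_zero_iff_norm, norm_smul, Real.norm_of_nonneg hs0.le]; field_simp)
  have h2 := (hconv x).2 (mem_univ 0) (mem_univ p) (sub_nonneg.2 hs1) hs0.le (by ring)
  simp only [smul_zero, zero_add, smul_eq_mul] at h2
  have h3 : (r / ‖p‖) * (C * ‖p‖) < (r / ‖p‖) * (H (x, p) - H (x, 0)) := by
    have : (r / ‖p‖) * (C * ‖p‖) = C * r := by field_simp
    rw [this]; linarith
  have := lt_of_mul_lt_mul_left h3 hs0.le
  linarith

/-- Locally in phase space, the supremum defining the Lagrangian may be restricted to a ball. -/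
lemma exists_eventually_inner_sub_le (hA1 : Continuous H)
    (hconv : ∀ x : Euc N, ConvexOn ℝ Set.univ fun p => H (x, p))
    (hsl : ∀ x : Euc N, ∀ C : ℝ, ∃ r : ℝ, ∀ p : Euc N, r ≤ ‖p‖ → C * ‖p‖ ≤ H (x, p))
    (z₀ : Euc N × Euc N) :
    ∃ r > (0 : ℝ), ∀ᶠ z : Euc N × Euc N in nhds z₀, ∀ p, r ≤ ‖p‖ →
      ⟪p, z.2⟫ - H (z.1, p) ≤ ⟪(0 : Euc N), z.2⟫ - H (z.1, 0) := by
  obtain ⟨r, hr, hev⟩ := exists_eventually_linear_growth hA1 hconv hsl z₀.1 (‖z₀.2‖ + 1)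
  refine ⟨r, hr, ?_⟩
  have h2 : ∀ᶠ z : Euc N × Euc N in nhds z₀, ‖z.2‖ < ‖z₀.2‖ + 1 :=
    (isOpen_lt (f := fun z : Euc N × Euc N => ‖z.2‖) (by fun_prop) continuous_const).mem_nhds
      (by simp)
  filter_upwards [continuous_fst.continuousAt.eventually hev, h2] with z hz hz2 p hp
  have h3 := hz p hp
  have h4 : ⟪p, z.2⟫ ≤ ‖p‖ * ‖z.2‖ := real_inner_le_norm _ _
  have h5 : ‖p‖ * ‖z.2‖ ≤ ‖p‖ * (‖z₀.2‖ + 1) := by gcongr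
  simp only [inner_zero_left]
  linarith

lemma exists_eventually_range_le_sSup_image (hA1 : Continuous H)
    (hconv : ∀ x : Euc N, ConvexOn ℝ Set.univ fun p => H (x, p))
    (hsl : ∀ x : Euc N, ∀ C : ℝ, ∃ r : ℝ, ∀ p : Euc N, r ≤ ‖p‖ → C * ‖p‖ ≤ H (x, p))
    (z₀ : Euc N × Euc N) :
    ∃ r > (0 : ℝ), ∀ᶠ z : Euc N × Euc N in nhds z₀, ∀ p,
      ⟪p, z.2⟫ - H (z.1, p) ≤
        sSup ((fun p : Euc N => ⟪p, z.2⟫ - H (z.1, p)) '' Metric.closedBall 0 r) := by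
  obtain ⟨r, hr, hev⟩ := exists_eventually_inner_sub_le hA1 hconv hsl z₀
  refine ⟨r, hr, hev.mono fun z hz p => ?_⟩
  have hc : Continuous fun p : Euc N => ⟪p, z.2⟫ - H (z.1, p) := by fun_prop
  have hle : ∀ p' ∈ Metric.closedBall (0 : Euc N) r, ⟪p', z.2⟫ - H (z.1, p') ≤
      sSup ((fun p : Euc N => ⟪p, z.2⟫ - H (z.1, p)) '' Metric.closedBall 0 r) := fun p' hp' =>
    le_csSup ((isCompact_closedBall _ _).image hc).bddAbove (mem_image_of_mem _ hp')
  rcases le_total r ‖p‖ with h | h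
  · exact (hz p h).trans (hle 0 (by simp [hr.le]))
  · exact hle p (by simpa using h)

lemma inner_le_lag_add (hA1 : Continuous H)
    (hconv : ∀ x : Euc N, ConvexOn ℝ Set.univ fun p => H (x, p))
    (hsl : ∀ x : Euc N, ∀ C : ℝ, ∃ r : ℝ, ∀ p : Euc N, r ≤ ‖p‖ → C * ‖p‖ ≤ H (x, p))
    (x p q : Euc N) : ⟪p, q⟫ ≤ Lag H (x, q) + H (x, p) := by
  obtain ⟨r, -, hev⟩ := exists_eventually_range_le_sSup_image hA1 hconv hsl (x, q)
  have : ⟪p, q⟫ - H (x, p) ≤ Lag H (x, q) :=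
    le_csSup ⟨_, by rintro _ ⟨p', rfl⟩; exact hev.self_of_nhds p'⟩ ⟨p, rfl⟩
  linarith

lemma continuous_lag (hA1 : Continuous H)
    (hconv : ∀ x : Euc N, ConvexOn ℝ Set.univ fun p => H (x, p))
    (hsl : ∀ x : Euc N, ∀ C : ℝ, ∃ r : ℝ, ∀ p : Euc N, r ≤ ‖p‖ → C * ‖p‖ ≤ H (x, p)) :
    Continuous (Lag H) := by
  rw [continuous_iff_continuousAt]
  intro z₀
  obtain ⟨r, hr, hev⟩ := exists_eventually_range_le_sSup_image hA1 hconv hsl z₀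
  have hc : Continuous fun z : Euc N × Euc N =>
      sSup ((fun p : Euc N => ⟪p, z.2⟫ - H (z.1, p)) '' Metric.closedBall 0 r) :=
    (isCompact_closedBall (0 : Euc N) r).continuous_sSup
      (f := fun (z : Euc N × Euc N) (p : Euc N) => ⟪p, z.2⟫ - H (z.1, p)) (by
        simp only [Function.HasUncurry.uncurry, id]; fun_prop)
  refine hc.continuousAt.congr (hev.mono fun z hz => le_antisymm ?_ ?_)
  · exact csSup_le_csSup ⟨_, by rintro _ ⟨p', rfl⟩; exact hz p'⟩
      ((Metric.nonempty_closedBall.2 hr.le).image _) (image_subset_range _ _)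
  · exact csSup_le (range_nonempty _) (by rintro _ ⟨p', rfl⟩; exact hz p')

/-- A subsolution of `H = a` forces the sublevel `{H(x,·) ≤ a}` to be nonempty at every `x`. -/
lemma exists_le_of_isSubsol (hA1 : Continuous H)
    (hcoer : ∀ R : ℝ, 0 < R → ∀ C : ℝ, ∃ r : ℝ, ∀ x p : Euc N,
      ‖x‖ ≤ R → r ≤ ‖p‖ → C ≤ H (x, p))
    {a : ℝ} {u : Euc N → ℝ} (hu : IsSubsol H a u) (x : Euc N) : ∃ p, H (x, p) ≤ a := by
  obtain ⟨r, hr⟩ := hcoer (‖x‖ + 1) (by positivity) (a + 1)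
  set F : Set (Euc N × Euc N) :=
    (Metric.closedBall x 1 ×ˢ Metric.closedBall 0 r) ∩ {z | H z ≤ a} with hF
  have hFc : IsCompact F := ((isCompact_closedBall _ _).prod (isCompact_closedBall _ _)).inter_right
    (isClosed_le hA1 continuous_const)
  have hFcl : IsClosed (Prod.fst '' F) := (hFc.image continuous_fst).isClosed
  have hae : ∀ᵐ y : Euc N, ∃ p, H (y, p) ≤ a := by
    filter_upwards [hu.2, hu.1.ae_differentiableAt] with y h1 h2 using ⟨_, h1 h2⟩
  have hdense : Dense {y : Euc N | ∃ p, H (y, p) ≤ a} := Measure.dense_of_ae hae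
  have hmem : x ∈ closure (Prod.fst '' F) := by
    have h1 : x ∈ closure (Metric.ball x 1 ∩ {y : Euc N | ∃ p, H (y, p) ≤ a}) :=
      hdense.open_subset_closure_inter Metric.isOpen_ball (Metric.mem_ball_self one_pos)
    refine closure_mono ?_ h1
    rintro y ⟨hy, p, hp⟩
    refine ⟨(y, p), ⟨⟨Metric.ball_subset_closedBall hy, ?_⟩, hp⟩, rfl⟩
    rw [mem_closedBall_zero_iff]
    by_contra hlt
    have hyn : ‖y‖ ≤ ‖x‖ + 1 := by
      have := norm_sub_norm_le y x
      have h3 : ‖y - x‖ < 1 := by simpa [dist_eq_norm] using hy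
      linarith
    have := hr y p hyn (not_le.1 hlt).le
    linarith
  rw [hFcl.closure_eq] at hmem
  obtain ⟨⟨y, p⟩, hz, rfl⟩ := hmem
  exact ⟨p, hz.2⟩

end Lagrangian

/-- For positions in a ball, a momentum `p` whose pairing with every velocity of some bounded set
is below the Lagrangian satisfies `H (x, p) < 0`. -/
lemma exists_bound_lt_zero_of_inner_lt_lag {N : ℕ} {H : Euc N × Euc N → ℝ} (hA1 : Continuous H)
    (hconv : ∀ x : Euc N, ConvexOn ℝ Set.univ fun p => H (x, p))
    (hcoer : ∀ R : ℝ, 0 < R → ∀ C : ℝ, ∃ r : ℝ, ∀ x p : Euc N,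
      ‖x‖ ≤ R → r ≤ ‖p‖ → C ≤ H (x, p))
    (hne : ∀ x, ∃ p, H (x, p) ≤ 1) {R : ℝ} (hR : 0 < R) :
    ∃ M > (0 : ℝ), ∀ x p : Euc N, ‖x‖ ≤ R →
      (∀ q : Euc N, ‖q‖ ≤ M → ⟪p, q⟫ < Lag H (x, q)) → H (x, p) < 0 := by
  obtain ⟨r, hr⟩ := hcoer R hR 2
  set P : ℝ := max r 1 with hP
  have hP1 : 1 ≤ P := le_max_right _ _
  have hrP : ∀ x p : Euc N, ‖x‖ ≤ R → P ≤ ‖p‖ → 2 ≤ H (x, p) := fun x p hx hp =>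
    hr x p hx ((le_max_left _ _).trans hp)
  obtain ⟨B, hB⟩ := ((isCompact_closedBall (0 : Euc N) R).prod
    (isCompact_closedBall (0 : Euc N) (3 * P + 1))).exists_bound_of_continuousOn hA1.continuousOn
  have hB' : ∀ x p : Euc N, ‖x‖ ≤ R → ‖p‖ ≤ 3 * P + 1 → |H (x, p)| ≤ B := fun x p hx hp =>
    hB (x, p) ⟨by simpa using hx, by simpa using hp⟩
  have hB0 : 0 ≤ B := (abs_nonneg _).trans (hB' 0 0 (by simpa using hR.le) (by
    rw [norm_zero]; linarith))
  have hsub : ∀ x p : Euc N, ‖x‖ ≤ R → ‖p‖ ≤ 3 * P → ∃ q : Euc N, ‖q‖ ≤ 2 * B + 1 ∧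
      (∀ p', H (x, p) + ⟪q, p' - p⟫ ≤ H (x, p')) ∧ Lag H (x, q) ≤ ⟪p, q⟫ - H (x, p) := by
    intro x p hx hp
    obtain ⟨q, hq⟩ := exists_subgradient (hconv x) (by fun_prop) p
    refine ⟨q, ?_, hq, ?_⟩
    · rcases eq_or_ne q 0 with rfl | hq0
      · rw [norm_zero]; linarith
      have hqn : 0 < ‖q‖ := norm_pos_iff.2 hq0
      have hunit : ‖(‖q‖⁻¹ • q)‖ = 1 := by
        rw [norm_smul, norm_inv, norm_norm, inv_mul_cancel₀ hqn.ne']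
      have h1 := hq (p + ‖q‖⁻¹ • q)
      rw [add_sub_cancel_left, inner_smul_right, real_inner_self_eq_norm_sq] at h1
      have h2 : ‖q‖⁻¹ * ‖q‖ ^ 2 = ‖q‖ := by field_simp
      rw [h2] at h1
      have h3 := (abs_le.1 (hB' x p hx (by linarith))).1
      have h4 := (abs_le.1 (hB' x (p + ‖q‖⁻¹ • q) hx (by
        have := norm_add_le p (‖q‖⁻¹ • q); linarith))).2
      linarith
    · refine csSup_le (range_nonempty _) ?_
      rintro _ ⟨p', rfl⟩
      have := hq p'
      rw [inner_sub_right, real_inner_comm, real_inner_comm p q] at this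
      dsimp only
      linarith
  refine ⟨2 * B + 1, by linarith, fun x p hx hlt => ?_⟩
  by_contra! hge
  obtain ⟨p₀, hp₀⟩ := hne x
  have hp₀P : ‖p₀‖ < P := by
    by_contra! h
    have := hrP x p₀ hx h
    linarith
  rcases le_or_gt ‖p - p₀‖ (2 * P) with hnear | hfar
  · obtain ⟨q, hqM, -, hL⟩ := hsub x p hx (by
      have := norm_le_norm_add_norm_sub' p p₀
      linarith)
    have := hlt q hqM
    linarith
  · set t : ℝ := 2 * P / ‖p - p₀‖ with ht
    have hd : 0 < ‖p - p₀‖ := by linarith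
    have ht0 : 0 < t := by positivity
    have ht1 : t < 1 := by rwa [ht, div_lt_one hd]
    set p₁ : Euc N := p₀ + t • (p - p₀) with hp₁
    have hn : ‖p₁ - p₀‖ = 2 * P := by
      rw [hp₁, add_sub_cancel_left, norm_smul, Real.norm_of_nonneg ht0.le, ht]; field_simp
    obtain ⟨q, hqM, hq, hL⟩ := hsub x p₁ hx (by
      have := norm_le_norm_add_norm_sub' p₁ p₀
      linarith)
    have hH1 : 2 ≤ H (x, p₁) := hrP x p₁ hx (by
      have := norm_sub_le p₁ p₀
      linarith)
    have h1 := hq p₀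
    have e1 : p₀ - p₁ = -(t • (p - p₀)) := by rw [hp₁]; abel
    have e2 : p = p₁ + (1 - t) • (p - p₀) := by rw [hp₁]; module
    rw [e1, inner_neg_right, inner_smul_right] at h1
    have h2 : 0 < ⟪q, p - p₀⟫ := by
      by_contra! h
      have := mul_nonpos_of_nonneg_of_nonpos ht0.le h
      linarith
    have h3 := hlt q hqM
    have h4 : ⟪p, q⟫ = ⟪p₁, q⟫ + (1 - t) * ⟪q, p - p₀⟫ := by
      conv_lhs => rw [e2]
      rw [inner_add_left, inner_smul_left, real_inner_comm q (p - p₀)]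
      simp
    have h5 : 0 < (1 - t) * ⟪q, p - p₀⟫ := mul_pos (by linarith) h2
    linarith

lemma DifferentiableAt.gradient_eq_of_eventually_le {E : Type*} [NormedAddCommGroup E]
    [InnerProductSpace ℝ E] [CompleteSpace E] {f g : E → ℝ} {x : E}
    (hf : DifferentiableAt ℝ f x) (hg : DifferentiableAt ℝ g x) (hle : ∀ᶠ y in nhds x, f y ≤ g y)
    (heq : f x = g x) : gradient f x = gradient g x := by
  have hmin : IsLocalMin (fun y => g y - f y) x := by
    filter_upwards [hle] with y hy
    rw [heq, sub_self]
    exact sub_nonneg.2 hy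
  have h0 := hmin.fderiv_eq_zero
  rw [fderiv_fun_sub hg hf, sub_eq_zero] at h0
  rw [gradient, gradient, h0]

lemma norm_gradient_le_of_lipschitzWith {E : Type*} [NormedAddCommGroup E]
    [InnerProductSpace ℝ E] [CompleteSpace E] {f : E → ℝ} {K : NNReal} (hf : LipschitzWith K f)
    (x : E) : ‖gradient f x‖ ≤ K := by
  rw [gradient, LinearIsometryEquiv.norm_map]
  exact norm_fderiv_le_of_lipschitz ℝ hf

/-- A `C¹` strict subsolution on a large ball is turned into a global one, by truncating it with
a cone and a constant where the Hamiltonian is negative at small momenta. -/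
lemma exists_isSubsol_of_contDiff {N : ℕ} {H : Euc N × Euc N → ℝ} {ε m a R C : ℝ} (hε : 0 < ε)
    (hR : 0 < R) (hm : ∀ x : Euc N, R ≤ ‖x‖ → ∀ p : Euc N, ‖p‖ ≤ ε → H (x, p) ≤ m)
    (hma : m ≤ a) {v : Euc N → ℝ} (hv : ContDiff ℝ 1 v)
    (hvH : ∀ x : Euc N, ‖x‖ ≤ R + 2 * C / ε → H (x, gradient v x) ≤ a)
    (hC : 0 ≤ C) (hvC : ∀ x : Euc N, ‖x‖ ≤ R → |v x| ≤ C) :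
    ∃ w, IsSubsol H a w := by
  set G : Euc N → ℝ := fun x => C - ε * (‖x‖ - R) with hG
  have hGlip : LipschitzWith ⟨ε, hε.le⟩ G := by
    refine LipschitzWith.of_dist_le_mul fun x y => ?_
    rw [Real.dist_eq, dist_eq_norm]
    have : G x - G y = -(ε * (‖x‖ - ‖y‖)) := by simp only [hG]; ring
    rw [this, abs_neg, abs_mul, abs_of_pos hε]
    exact mul_le_mul_of_nonneg_left (abs_norm_sub_norm_le x y) hε.le
  refine ⟨fun x => max (min (v x) (G x)) (-C),
    (hv.locallyLipschitz.min hGlip.locallyLipschitz).max_const _, ?_⟩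
  refine Filter.Eventually.of_forall fun x hdiff => ?_
  set w : Euc N → ℝ := fun x => max (min (v x) (G x)) (-C) with hw
  have hvd : DifferentiableAt ℝ v x := hv.differentiable one_ne_zero x
  rcases lt_or_ge ‖x‖ R with hxR | hxR
  · have hloc : w =ᶠ[nhds x] v := by
      filter_upwards [Metric.isOpen_ball.mem_nhds (mem_ball_zero_iff.2 hxR)] with y hy
      have hy' : ‖y‖ < R := mem_ball_zero_iff.1 hy
      have h1 := abs_le.1 (hvC y hy'.le)
      have h2 : C ≤ G y := by
        have : 0 ≤ ε * (R - ‖y‖) := mul_nonneg hε.le (by linarith)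
        simp only [hG]; linarith
      simp only [hw]
      rw [min_eq_left (h1.2.trans h2), max_eq_left h1.1]
    have hgr : gradient w x = gradient v x := by rw [gradient, gradient, hloc.fderiv_eq]
    rw [hgr]
    exact hvH x (by have : 0 ≤ 2 * C / ε := by positivity
                    linarith)
  rcases le_or_gt (min (v x) (G x)) (-C) with hlow | hhigh
  · have hgr : gradient (fun _ : Euc N => -C) x = gradient w x :=
      (differentiableAt_const _).gradient_eq_of_eventually_le hdiff
        (Filter.Eventually.of_forall fun y => le_max_right _ _) (max_eq_right hlow).symm
    rw [← hgr]
    refine (hm x hxR _ ?_).trans hma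
    simp [gradient, hε.le]
  have hc : Continuous fun y => min (v y) (G y) := hv.continuous.min hGlip.continuous
  have hloc : ∀ᶠ y in nhds x, w y = min (v y) (G y) := by
    filter_upwards [(isOpen_lt continuous_const hc).mem_nhds hhigh] with y hy
    exact max_eq_left (le_of_lt hy)
  have hwx : w x = min (v x) (G x) := max_eq_left hhigh.le
  rcases le_total (v x) (G x) with hvG | hGv
  · have hgr : gradient w x = gradient v x :=
      hdiff.gradient_eq_of_eventually_le hvd (hloc.mono fun y hy => hy.trans_le (min_le_left _ _))
        (by rw [hwx, min_eq_left hvG])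
    rw [hgr]
    refine hvH x ?_
    have h1 : -C < G x := hhigh.trans_le (min_le_right _ _)
    have h2 : ε * (‖x‖ - R) < 2 * C := by simp only [hG] at h1; linarith
    have h3 : ‖x‖ - R < 2 * C / ε := by rw [lt_div_iff₀ hε]; linarith
    linarith
  · have hx0 : x ≠ 0 := by
      rintro rfl
      rw [norm_zero] at hxR
      linarith
    have hGd : DifferentiableAt ℝ G x :=
      (((differentiableAt_id.norm ℝ hx0).sub_const R).const_mul ε).const_sub C
    have hgr : gradient w x = gradient G x :=
      hdiff.gradient_eq_of_eventually_le hGd (hloc.mono fun y hy => hy.trans_le (min_le_right _ _))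
        (by rw [hwx, min_eq_right hGv])
    rw [hgr]
    exact (hm x hxR _ (norm_gradient_le_of_lipschitzWith hGlip x)).trans hma

/-- A subsolution for a continuous `Φ` can be mollified into a `C¹` function which is almost a
subsolution on a given bounded set. -/
lemma SubsolFor.exists_contDiff_fderiv_le {N : ℕ} {Φ : Euc N × Euc N → ℝ} (hΦ : Continuous Φ)
    {u : Euc N → ℝ} (hu : SubsolFor Φ u) (R M : ℝ) {η : ℝ} (hη : 0 < η) :
    ∃ v : Euc N → ℝ, ContDiff ℝ 1 v ∧
      ∀ x q : Euc N, ‖x‖ ≤ R → ‖q‖ ≤ M → fderiv ℝ v x q ≤ Φ (x, q) + η := by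
  have hunif := ((isCompact_closedBall (0 : Euc N) (R + 1)).prod
    (isCompact_closedBall (0 : Euc N) M)).uniformContinuousOn_of_continuous hΦ.continuousOn
  obtain ⟨δ, hδ, hδΦ⟩ := Metric.uniformContinuousOn_iff.1 hunif η hη
  obtain ⟨K, w, hw, heq⟩ := hu.1.exists_lipschitzWith_eqOn_closedBall (R + 2)
  have hae : ∀ᵐ y : Euc N, DifferentiableAt ℝ w y ∧
      (‖y‖ ≤ R + 1 → ∀ q : Euc N, fderiv ℝ w y q ≤ Φ (y, q)) := by
    filter_upwards [hu.2, hw.ae_differentiableAt (μ := volume)] with y h1 h2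
    refine ⟨h2, fun hy q => ?_⟩
    have hloc : u =ᶠ[nhds y] w := by
      filter_upwards [Metric.isOpen_ball.mem_nhds
        (mem_ball_zero_iff.2 (show ‖y‖ < R + 2 by linarith))] with z hz
      exact heq (Metric.ball_subset_closedBall hz)
    rw [← hloc.fderiv_eq]
    exact h1 (h2.congr_of_eventuallyEq hloc) q
  have hδ' : 0 < min δ 1 := lt_min hδ one_pos
  let φ : ContDiffBump (0 : Euc N) := ⟨min δ 1 / 2, min δ 1, half_pos hδ', half_lt_self hδ'⟩
  set ρ : Euc N → ℝ := φ.normed volume with hρ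
  have hρc : Continuous ρ := φ.continuous_normed
  have hρi : Integrable ρ := φ.integrable_normed
  have hρs : HasCompactSupport ρ := φ.hasCompactSupport_normed
  have hρ0 : ∀ t, 0 ≤ ρ t := fun t => φ.nonneg_normed t
  have hρsupp : ∀ t, ρ t ≠ 0 → ‖t‖ < min δ 1 := by
    intro t ht
    have h1 : t ∈ Function.support ρ := ht
    rw [hρ, φ.support_normed_eq] at h1
    exact mem_ball_zero_iff.1 h1
  have hsmooth : ContDiff ℝ 1 (convolution ρ w (ContinuousLinearMap.lsmul ℝ ℝ) volume) :=
    hρs.contDiff_convolution_left _ (φ.contDiff_normed (n := 1)) hw.continuous.locallyIntegrable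
  refine ⟨_, hsmooth, fun x q hx hq => ?_⟩
  have haex : ∀ᵐ t : Euc N, DifferentiableAt ℝ w (x - t) ∧
      (‖x - t‖ ≤ R + 1 → ∀ q : Euc N, fderiv ℝ w (x - t) q ≤ Φ (x - t, q)) :=
    (Measure.measurePreserving_sub_left volume x).quasiMeasurePreserving.ae hae
  have hderiv := hasFDerivAt_integral_of_dominated_loc_of_lip (μ := volume) (x₀ := x)
    (F := fun (y : Euc N) (t : Euc N) => ρ t • w (y - t))
    (F' := fun t => ρ t • fderiv ℝ w (x - t)) (bound := fun t => ρ t * K)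
    (s := univ) Filter.univ_mem
    (Filter.Eventually.of_forall fun y => by
      have := hw.continuous
      exact (by fun_prop : Continuous fun t => ρ t • w (y - t)).aestronglyMeasurable)
    (by
      have := hw.continuous
      exact (by fun_prop : Continuous fun t => ρ t • w (x - t)).integrable_of_hasCompactSupport
        hρs.smul_right)
    (by
      refine hρc.aestronglyMeasurable.smul ?_
      exact ((measurable_fderiv ℝ w).comp (measurable_const.sub measurable_id)
        ).aestronglyMeasurable)
    (Filter.Eventually.of_forall fun t => by
      refine LipschitzOnWith.of_dist_le_mul fun y _ z _ => ?_
      have h1 := hw.dist_le_mul (y - t) (z - t)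
      rw [dist_sub_right] at h1
      rw [dist_smul₀, Real.norm_of_nonneg (hρ0 t), Real.coe_nnabs,
        abs_of_nonneg (mul_nonneg (hρ0 t) K.coe_nonneg), mul_assoc]
      exact mul_le_mul_of_nonneg_left h1 (hρ0 t))
    (hρi.mul_const _)
    (haex.mono fun t ht => by
      have h1 := ht.1.hasFDerivAt.comp x ((hasFDerivAt_id x).sub_const t)
      exact h1.const_smul (ρ t))
  have hfd : HasFDerivAt (convolution ρ w (ContinuousLinearMap.lsmul ℝ ℝ) volume)
      (∫ t, ρ t • fderiv ℝ w (x - t)) x := hderiv.2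
  rw [hfd.fderiv, ContinuousLinearMap.integral_apply hderiv.1]
  have hle : ∫ t, (ρ t • fderiv ℝ w (x - t)) q ≤ ∫ t, ρ t * (Φ (x, q) + η) := by
    refine integral_mono_ae (hderiv.1.apply_continuousLinearMap q) (hρi.mul_const _) ?_
    filter_upwards [haex] with t ht
    rw [smul_apply, smul_eq_mul]
    rcases eq_or_ne (ρ t) 0 with h0 | h0
    · rw [h0, zero_mul, zero_mul]
    refine mul_le_mul_of_nonneg_left ?_ (hρ0 t)
    have htn := hρsupp t h0
    have hxt : ‖x - t‖ ≤ R + 1 := by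
      have := norm_sub_le x t
      have := min_le_right δ 1
      linarith
    refine (ht.2 hxt q).trans ?_
    have hd := hδΦ (x - t, q) ⟨by simpa using hxt, by simpa using hq⟩
      (x, q) ⟨by simp only [mem_closedBall_zero_iff]; linarith, by simpa using hq⟩ (by
        rw [Prod.dist_eq, dist_self, dist_eq_norm, sub_sub_cancel_left, norm_neg]
        exact max_lt (htn.trans_le (min_le_left _ _)) hδ)
    rw [Real.dist_eq] at hd
    have := (abs_lt.1 hd).2
    linarith
  rwa [integral_mul_const, φ.integral_normed, one_mul] at hle

/-- If no element of a subspace `V` lies strictly below `L`, then some probability measure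
annihilates `V` and gives `L` a nonpositive integral. -/
lemma exists_isProbabilityMeasure_integral_nonpos {X : Type*} [TopologicalSpace X] [T2Space X]
    [CompactSpace X] [MeasurableSpace X] [BorelSpace X] (V : Submodule ℝ C(X, ℝ)) (L : C(X, ℝ))
    (hL : ∀ v ∈ V, ∃ x, L x ≤ v x) (hV : ∀ v ∈ V, ∃ x, v x ≤ 0) :
    ∃ ν : Measure X, IsProbabilityMeasure ν ∧ (∀ v ∈ V, ∫ x, v x ∂ν = 0) ∧ ∫ x, L x ∂ν ≤ 0 := by
  set s : Set C(X, ℝ) := {f | ∀ x, 0 < f x} with hs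
  set t : Set C(X, ℝ) := {f | ∃ c : ℝ, 0 ≤ c ∧ ∃ v ∈ V, f = c • L + v} with ht
  have hsopen : IsOpen s := by
    have := ContinuousMap.isOpen_setOfPred_mapsTo (X := X) (Y := ℝ) isCompact_univ
      (isOpen_Ioi (a := (0 : ℝ)))
    simpa [MapsTo, hs] using this
  have hsconv : Convex ℝ s := by
    intro f hf g hg a b ha hb hab x
    have h1 := hf x
    have h2 := hg x
    simp only [ContinuousMap.add_apply, ContinuousMap.smul_apply, smul_eq_mul]
    rcases eq_or_lt_of_le ha with rfl | ha'
    · have : b = 1 := by linarith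
      subst this; simpa using h2
    · have := mul_pos ha' h1
      have := mul_nonneg hb h2.le
      linarith
  have htconv : Convex ℝ t := by
    rintro _ ⟨c, hc, v, hv, rfl⟩ _ ⟨d, hd, w, hw, rfl⟩ a b ha hb -
    refine ⟨a * c + b * d, by positivity, a • v + b • w,
      V.add_mem (V.smul_mem _ hv) (V.smul_mem _ hw), by module⟩
  have hdisj : Disjoint s t := by
    rw [Set.disjoint_left]
    rintro _ hf ⟨c, hc, v, hv, rfl⟩
    rcases eq_or_lt_of_le hc with rfl | hc'
    · obtain ⟨x, hx⟩ := hV v hv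
      have := hf x
      simp only [zero_smul, zero_add] at this
      linarith
    · obtain ⟨x, hx⟩ := hL (-(c⁻¹ • v)) (V.neg_mem (V.smul_mem _ hv))
      have h1 := hf x
      simp only [ContinuousMap.add_apply, ContinuousMap.smul_apply, smul_eq_mul,
        ContinuousMap.neg_apply] at h1 hx
      have h2 := mul_le_mul_of_nonneg_left hx hc
      have h3 : c * -(c⁻¹ * v x) = -v x := by field_simp
      linarith
  obtain ⟨f, b, hfs, hft⟩ := geometric_hahn_banach_open hsconv hsopen htconv hdisj
  have hb0 : b ≤ 0 := by
    simpa using hft 0 ⟨0, le_rfl, 0, V.zero_mem, by simp⟩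
  have hneg : ∀ g ∈ s, f g < 0 := fun g hg => (hfs g hg).trans_le hb0
  have hone : f 1 < 0 := hneg 1 fun x => by simp
  have hnonpos : ∀ g : C(X, ℝ), 0 ≤ g → f g ≤ 0 := by
    intro g hg
    refine le_of_forall_pos_le_add fun e he => ?_
    have h1 := hneg (g + (e / -f 1) • 1) fun x => by
      have : 0 ≤ g x := hg x
      have h2 : 0 < e / -f 1 := div_pos he (by linarith)
      simp only [ContinuousMap.add_apply, ContinuousMap.smul_apply, smul_eq_mul,
        ContinuousMap.one_apply]
      linarith
    rw [map_add, map_smul, smul_eq_mul] at h1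
    have h2 : e / -f 1 * f 1 = -e := by
      have := hone.ne
      field_simp
    linarith
  have hcone : ∀ k : ℝ, 0 ≤ k → ∀ g ∈ t, b ≤ k * f g := by
    rintro k hk _ ⟨c, hc, v, hv, rfl⟩
    have := hft (k • (c • L + v)) ⟨k * c, by positivity, k • v, V.smul_mem _ hv, by module⟩
    rwa [map_smul, smul_eq_mul] at this
  have htnonneg : ∀ g ∈ t, 0 ≤ f g := by
    intro g hg
    by_contra! h
    have := hcone ((b - 1) / f g) (div_nonneg_of_nonpos (by linarith) h.le) g hg
    rw [div_mul_cancel₀ _ h.ne] at this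
    linarith
  have hfV : ∀ v ∈ V, f v = 0 := by
    intro v hv
    have h1 := htnonneg v ⟨0, le_rfl, v, hv, by simp⟩
    have h2 := htnonneg (-v) ⟨0, le_rfl, -v, V.neg_mem hv, by simp⟩
    rw [map_neg] at h2
    linarith
  have hfL : 0 ≤ f L := htnonneg L ⟨1, zero_le_one, 0, V.zero_mem, by simp⟩
  let Λ₀ : CompactlySupportedContinuousMap X ℝ →ₗ[ℝ] ℝ :=
    { toFun := fun g => (f 1)⁻¹ * f g.toContinuousMap
      map_add' := fun g h => by
        have : (g + h).toContinuousMap = g.toContinuousMap + h.toContinuousMap := rfl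
        rw [this, map_add, mul_add]
      map_smul' := fun c g => by
        have : (c • g).toContinuousMap = c • g.toContinuousMap := rfl
        rw [this, map_smul, smul_eq_mul, smul_eq_mul, RingHom.id_apply]; ring }
  let Λ : CompactlySupportedContinuousMap X ℝ →ₚ[ℝ] ℝ := PositiveLinearMap.mk₀ Λ₀ fun g hg =>
    mul_nonneg_of_nonpos_of_nonpos (inv_nonpos.2 hone.le) (hnonpos _ fun x => hg x)
  have hint : ∀ g : C(X, ℝ), ∫ x, g x ∂(RealRMK.rieszMeasure Λ) = (f 1)⁻¹ * f g := fun g =>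
    RealRMK.integral_rieszMeasure Λ ⟨g, HasCompactSupport.of_compactSpace _⟩
  refine ⟨RealRMK.rieszMeasure Λ, ?_, fun v hv => ?_, ?_⟩
  · have h1 := hint 1
    rw [inv_mul_cancel₀ hone.ne] at h1
    simp only [ContinuousMap.one_apply, integral_const, smul_eq_mul, mul_one] at h1
    exact ⟨by rwa [measureReal_def, ENNReal.toReal_eq_one_iff] at h1⟩
  · rw [hint, hfV v hv, mul_zero]
  · rw [hint]
    exact mul_nonpos_of_nonpos_of_nonneg (inv_nonpos.2 hone.le) hfL

/-- The pairings `(x, q) ↦ Dv(x) q` of `C¹` functions `v`, restricted to a set `K`. -/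
def exactForms {N : ℕ} (K : Set (Euc N × Euc N)) : Submodule ℝ C(K, ℝ) where
  carrier := {f | ∃ v : Euc N → ℝ, ContDiff ℝ 1 v ∧ ∀ z : K, f z = fderiv ℝ v z.1.1 z.1.2}
  add_mem' := by
    rintro f g ⟨v, hv, hf⟩ ⟨w, hw, hg⟩
    refine ⟨v + w, hv.add hw, fun z => ?_⟩
    rw [fderiv_add (hv.differentiable one_ne_zero _) (hw.differentiable one_ne_zero _),
      ContinuousMap.add_apply, hf, hg, add_apply]
  zero_mem' := ⟨0, contDiff_const, fun z => by simp⟩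
  smul_mem' := by
    rintro c f ⟨v, hv, hf⟩
    refine ⟨c • v, hv.const_smul c, fun z => ?_⟩
    rw [fderiv_const_smul (hv.differentiable one_ne_zero _),
      ContinuousMap.smul_apply, hf, smul_apply]

lemma inner_gradient_eq_fderiv {E : Type*} [NormedAddCommGroup E] [InnerProductSpace ℝ E]
    [CompleteSpace E] (u : E → ℝ) (x q : E) : ⟪gradient u x, q⟫ = fderiv ℝ u x q := by
  rw [gradient, InnerProductSpace.toDual_symm_apply]

lemma continuous_gradient_of_contDiff {E : Type*} [NormedAddCommGroup E] [InnerProductSpace ℝ E]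
    [CompleteSpace E] {v : E → ℝ} (hv : ContDiff ℝ 1 v) : Continuous (gradient v) :=
  (InnerProductSpace.toDual ℝ E).symm.continuous.comp (hv.continuous_fderiv one_ne_zero)

/-- On a centred ball, a gradient bound controls the oscillation around the value at `0`. -/
lemma abs_sub_le_of_norm_gradient_le {E : Type*} [NormedAddCommGroup E] [InnerProductSpace ℝ E]
    [CompleteSpace E] {v : E → ℝ} (hv : Differentiable ℝ v) {r R : ℝ}
    (hr : ∀ x, ‖x‖ ≤ R → ‖gradient v x‖ ≤ r) {x : E} (hx : ‖x‖ ≤ R) :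
    |v x - v 0| ≤ r * R := by
  have h0 : (0 : E) ∈ Metric.closedBall (0 : E) R := by simpa using (norm_nonneg x).trans hx
  have h := (convex_closedBall (0 : E) R).norm_image_sub_le_of_norm_fderiv_le (𝕜 := ℝ) (f := v)
    (C := r) (fun y _ => hv y) (fun y hy => by
      have := hr y (by simpa using hy)
      rwa [gradient, LinearIsometryEquiv.norm_map] at this)
    h0 (show x ∈ Metric.closedBall 0 R by simpa using hx)
  rw [sub_zero] at h
  refine h.trans (mul_le_mul_of_nonneg_left hx ?_)
  exact (norm_nonneg _).trans (hr 0 (by simpa using h0))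

/-- A bounded set of positions and velocities on which no `C¹` pairing stays strictly below the
Lagrangian, when `0` is the critical value. -/
lemma exists_ball_forall_lag_le_fderiv {N : ℕ} {H : Euc N × Euc N → ℝ} (hA1 : Continuous H)
    (hconv : ∀ x : Euc N, ConvexOn ℝ Set.univ fun p => H (x, p))
    (hcoer : ∀ R : ℝ, 0 < R → ∀ C : ℝ, ∃ r : ℝ, ∀ x p : Euc N,
      ‖x‖ ≤ R → r ≤ ‖p‖ → C ≤ H (x, p))
    {ε m R : ℝ} (hε : 0 < ε) (hm0 : m < 0)
    (hm : ∀ x : Euc N, R ≤ ‖x‖ → ∀ p : Euc N, ‖p‖ ≤ ε → H (x, p) ≤ m)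
    (hne : ∀ x, ∃ p, H (x, p) ≤ 1) (hcrit : ∀ a u, IsSubsol H a u → 0 ≤ a) :
    ∃ R' > (0 : ℝ), ∃ M > (0 : ℝ), ∀ v : Euc N → ℝ, ContDiff ℝ 1 v →
      ∃ x q : Euc N, ‖x‖ ≤ R' ∧ ‖q‖ ≤ M ∧ Lag H (x, q) ≤ fderiv ℝ v x q := by
  set R₁ : ℝ := max R 1 with hR₁
  have hR₁0 : 0 < R₁ := one_pos.trans_le (le_max_right _ _)
  obtain ⟨r, hr⟩ := hcoer R₁ hR₁0 0
  set C : ℝ := max r 0 * R₁ with hC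
  have hC0 : 0 ≤ C := by positivity
  set R' : ℝ := R₁ + 2 * C / ε with hR'
  have hRR' : R₁ ≤ R' := by
    have : 0 ≤ 2 * C / ε := by positivity
    linarith
  obtain ⟨M, hM, hMH⟩ := exists_bound_lt_zero_of_inner_lt_lag hA1 hconv hcoer hne
    (hR₁0.trans_le hRR')
  refine ⟨R', hR₁0.trans_le hRR', M, hM, fun v hv => ?_⟩
  by_contra! hcon
  have hneg : ∀ x : Euc N, ‖x‖ ≤ R' → H (x, gradient v x) < 0 := fun x hx =>
    hMH x _ hx fun q hq => by rw [inner_gradient_eq_fderiv]; exact hcon x q hx hq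
  have hcont : Continuous fun x => H (x, gradient v x) :=
    hA1.comp (continuous_id.prodMk (continuous_gradient_of_contDiff hv))
  obtain ⟨y, hy, hmax⟩ := (isCompact_closedBall (0 : Euc N) R').exists_isMaxOn
    (Metric.nonempty_closedBall.2 (hR₁0.trans_le hRR').le) hcont.continuousOn
  have hyneg := hneg y (by simpa using hy)
  have hgrad : ∀ x : Euc N, gradient (fun x => v x - v 0) x = gradient v x := fun x => by
    rw [gradient, gradient, fderiv_sub_const]
  obtain ⟨w, hw⟩ := exists_isSubsol_of_contDiff (H := H) (a := max m (H (y, gradient v y)))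
    (v := fun x => v x - v 0) (C := C) hε hR₁0
    (fun x hx p hp => hm x ((le_max_left _ _).trans hx) p hp) (le_max_left _ _)
    (hv.sub contDiff_const)
    (fun x hx => by
      rw [hgrad]
      exact (hmax (show x ∈ Metric.closedBall 0 R' by simpa using hx)).trans (le_max_right _ _))
    hC0
    (fun x hx => abs_sub_le_of_norm_gradient_le (hv.differentiable one_ne_zero)
      (fun z hz => by
        by_contra! h
        have h1 := hr z (gradient v z) hz ((le_max_left _ _).trans h.le)
        have h2 := hneg z (hz.trans hRR')
        linarith) hx)
  exact absurd (hcrit _ _ hw) (not_le.2 (max_lt hm0 hyneg))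

lemma IsSubsol.subsolFor_lag_add {N : ℕ} {H : Euc N × Euc N → ℝ} (hA1 : Continuous H)
    (hconv : ∀ x : Euc N, ConvexOn ℝ Set.univ fun p => H (x, p))
    (hsl : ∀ x : Euc N, ∀ C : ℝ, ∃ r : ℝ, ∀ p : Euc N, r ≤ ‖p‖ → C * ‖p‖ ≤ H (x, p))
    {a : ℝ} {u : Euc N → ℝ} (hu : IsSubsol H a u) : SubsolFor (fun z => Lag H z + a) u := by
  refine ⟨hu.1, hu.2.mono fun x hx hd q => ?_⟩
  rw [← inner_gradient_eq_fderiv]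
  have := inner_le_lag_add hA1 hconv hsl x (gradient u x) q
  have := hx hd
  linarith

/-- If the Hamiltonian is bounded at small momenta far away, then constants are subsolutions at
some level. -/
lemma exists_isSubsol {N : ℕ} {H : Euc N × Euc N → ℝ} (hA1 : Continuous H) {ε m R : ℝ}
    (hε : 0 < ε) (hm : ∀ x : Euc N, R ≤ ‖x‖ → ∀ p : Euc N, ‖p‖ ≤ ε → H (x, p) ≤ m) :
    ∃ a u, IsSubsol H a u := by
  obtain ⟨B, hB⟩ := (isCompact_closedBall (0 : Euc N) R).exists_bound_of_continuousOn
    (f := fun x => H (x, 0)) (by fun_prop : Continuous fun x : Euc N => H (x, 0)).continuousOn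
  refine ⟨max m B, fun _ => 0, LocallyLipschitz.const _, Filter.Eventually.of_forall fun x _ => ?_⟩
  have hg : gradient (fun _ : Euc N => (0 : ℝ)) x = 0 := by simp [gradient]
  rw [hg]
  rcases le_total R ‖x‖ with h | h
  · exact (hm x h 0 (by simpa using hε.le)).trans (le_max_left _ _)
  · exact ((le_abs_self _).trans (hB x (by simpa using h))).trans (le_max_right _ _)

/-- By coercivity, a fibre of `H` which lies strictly above a constant is uniformly
bounded away from it. -/
lemma exists_lt_forall_le_fibre {N : ℕ} {H : Euc N × Euc N → ℝ} (hA1 : Continuous H)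
    (hcoer : ∀ R : ℝ, 0 < R → ∀ C : ℝ, ∃ r : ℝ, ∀ x p : Euc N,
      ‖x‖ ≤ R → r ≤ ‖p‖ → C ≤ H (x, p))
    {m : ℝ} {x : Euc N} (hx : ∀ p, m < H (x, p)) : ∃ m' > m, ∀ p, m' ≤ H (x, p) := by
  obtain ⟨r, hr⟩ := hcoer (‖x‖ + 1) (by positivity) (m + 1)
  obtain ⟨p₀, -, hp₀⟩ := (isCompact_closedBall (0 : Euc N) (max r 0)).exists_isMinOn
    (Metric.nonempty_closedBall.2 (le_max_right _ _))
    (by fun_prop : Continuous fun p : Euc N => H (x, p)).continuousOn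
  refine ⟨min (H (x, p₀)) (m + 1), lt_min (hx p₀) (by linarith), fun p => ?_⟩
  rcases le_total ‖p‖ (max r 0) with h | h
  · exact (min_le_left _ _).trans (hp₀ (show p ∈ Metric.closedBall 0 (max r 0) by simpa using h))
  · exact (min_le_right _ _).trans (hr x p (by linarith) ((le_max_left _ _).trans h))

theorem stmt10 {N : ℕ} (hN : 1 ≤ N) (H : Euc N × Euc N → ℝ)
    (hA1 : Continuous H)
    (hA2conv : ∀ x : Euc N, ConvexOn ℝ Set.univ fun p => H (x, p))
    (hA2coer : ∀ R : ℝ, 0 < R → ∀ C : ℝ, ∃ r : ℝ, ∀ x p : Euc N,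
      ‖x‖ ≤ R → r ≤ ‖p‖ → C ≤ H (x, p))
    (hA3 : ∃ ε > (0 : ℝ), ∃ m : ℝ,
      (∃ R : ℝ, ∀ x : Euc N, R ≤ ‖x‖ → ∀ p : Euc N, ‖p‖ ≤ ε → H (x, p) ≤ m) ∧
      (∃ x₀ : Euc N, ∀ p : Euc N, m < H (x₀, p)))
    (hcrit : sInf {a : ℝ | ∃ u : Euc N → ℝ, IsSubsol H a u} = 0)
    (hsl : ∀ x : Euc N, ∀ C : ℝ, ∃ r : ℝ, ∀ p : Euc N, r ≤ ‖p‖ → C * ‖p‖ ≤ H (x, p))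
 :
    ∃ μ : Measure (Euc N × Euc N), MatherMeasure H μ := by
  obtain ⟨ε, hε, m, ⟨R, hm⟩, x₀, hx₀⟩ := hA3
  set S : Set ℝ := {a : ℝ | ∃ u : Euc N → ℝ, IsSubsol H a u} with hS
  obtain ⟨m', hmm', hm'⟩ := exists_lt_forall_le_fibre hA1 hA2coer hx₀
  have hlb : ∀ a ∈ S, m' ≤ a := by
    rintro a ⟨u, hu⟩
    obtain ⟨p, hp⟩ := exists_le_of_isSubsol hA1 hA2coer hu x₀
    exact (hm' p).trans hp
  have hSne : S.Nonempty := exists_isSubsol hA1 hε hm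
  have hm0 : m < 0 := hmm'.trans_le (hcrit ▸ le_csInf hSne hlb)
  have hcrit' : ∀ a u, IsSubsol H a u → 0 ≤ a := fun a u hu =>
    hcrit ▸ csInf_le ⟨m', hlb⟩ ⟨u, hu⟩
  have happrox : ∀ η > 0, ∃ a < η, ∃ u, IsSubsol H a u := fun η hη => by
    obtain ⟨a, ha, haη⟩ := exists_lt_of_csInf_lt hSne (hcrit.trans_lt hη)
    exact ⟨a, haη, ha⟩
  have hne : ∀ x, ∃ p, H (x, p) ≤ 1 := fun x => by
    obtain ⟨a, ha, u, hu⟩ := happrox 1 one_pos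
    obtain ⟨p, hp⟩ := exists_le_of_isSubsol hA1 hA2coer hu x
    exact ⟨p, hp.trans ha.le⟩
  obtain ⟨R', hR', M, hM, hball⟩ :=
    exists_ball_forall_lag_le_fderiv hA1 hA2conv hA2coer hε hm0 hm hne hcrit'
  have hLc := continuous_lag hA1 hA2conv hsl
  set K : Set (Euc N × Euc N) := Metric.closedBall 0 R' ×ˢ Metric.closedBall 0 M with hK
  have hKc : IsCompact K := (isCompact_closedBall _ _).prod (isCompact_closedBall _ _)
  have : CompactSpace K := isCompact_iff_compactSpace.mp hKc
  have hKmem : ∀ x q : Euc N, ‖x‖ ≤ R' → ‖q‖ ≤ M → (x, q) ∈ K := fun x q hx hq =>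
    ⟨by simpa using hx, by simpa using hq⟩
  obtain ⟨ν, hν, hνV, hνL⟩ := exists_isProbabilityMeasure_integral_nonpos (exactForms K)
    ⟨fun z : K => Lag H z, hLc.comp continuous_subtype_val⟩
    (by
      rintro f ⟨v, hv, hf⟩
      obtain ⟨x, q, hx, hq, h⟩ := hball v hv
      exact ⟨⟨(x, q), hKmem x q hx hq⟩, by rw [hf]; exact h⟩)
    (by
      rintro f ⟨v, hv, hf⟩
      exact ⟨⟨(0, 0), hKmem 0 0 (by simpa using hR'.le) (by simpa using hM.le)⟩, by simp [hf]⟩)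
  have hint : ∀ Φ : Euc N × Euc N → ℝ, Continuous Φ → Integrable (fun z : K => Φ z) ν :=
    fun Φ hΦ => (hΦ.comp continuous_subtype_val).integrable_of_hasCompactSupport
      (HasCompactSupport.of_compactSpace _)
  have hpos : ∀ Φ : Euc N × Euc N → ℝ, Continuous Φ → (∃ u, SubsolFor Φ u) →
      0 ≤ ∫ z : K, Φ z ∂ν := by
    rintro Φ hΦ ⟨u, hu⟩
    refine le_of_forall_pos_le_add fun η hη => ?_
    obtain ⟨v, hv, hle⟩ := hu.exists_contDiff_fderiv_le hΦ R' M hη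
    have hvc : Continuous fun z : Euc N × Euc N => fderiv ℝ v z.1 z.2 :=
      ((hv.continuous_fderiv one_ne_zero).comp continuous_fst).clm_apply continuous_snd
    have h0 : ∫ z : K, fderiv ℝ v z.1.1 z.1.2 ∂ν = 0 :=
      hνV ⟨fun z : K => fderiv ℝ v z.1.1 z.1.2, hvc.comp continuous_subtype_val⟩
        ⟨v, hv, fun z => rfl⟩
    have hmono : ∫ z : K, fderiv ℝ v z.1.1 z.1.2 ∂ν ≤ ∫ z : K, (Φ z + η) ∂ν :=
      integral_mono (hint _ hvc) ((hint _ hΦ).add (integrable_const _)) fun z =>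
        hle z.1.1 z.1.2 (by simpa using z.2.1) (by simpa using z.2.2)
    rw [h0, integral_add (hint _ hΦ) (integrable_const _)] at hmono
    simpa using hmono
  have hmap : ∀ Φ : Euc N × Euc N → ℝ, Continuous Φ →
      ∫ z, Φ z ∂(ν.map Subtype.val) = ∫ z : K, Φ z ∂ν := fun Φ hΦ =>
    integral_map measurable_subtype_coe.aemeasurable hΦ.aestronglyMeasurable
  refine ⟨ν.map Subtype.val, Measure.isProbabilityMeasure_map measurable_subtype_coe.aemeasurable,
    ?_, ?_, fun Φ hΦ _ hu _ => ?_⟩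
  · exact (integrable_map_measure hLc.aestronglyMeasurable
      measurable_subtype_coe.aemeasurable).2 (hint _ hLc)
  · rw [hmap _ hLc]
    refine le_antisymm hνL (le_of_forall_pos_le_add fun η hη => ?_)
    obtain ⟨a, haη, u, hu⟩ := happrox η hη
    have h := hpos (fun z => Lag H z + a) (hLc.add continuous_const)
      ⟨u, hu.subsolFor_lag_add hA1 hA2conv hsl⟩
    rw [integral_add (hint _ hLc) (integrable_const _)] at h
    simp only [integral_const, probReal_univ, one_smul] at h
    linarith
  · rw [hmap _ hΦ]
    exact hpos Φ hΦ hu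

end
end

section
/- For a Borel probability measure μ on ℝ^N × ℝ^N the following three conditions are equivalent: (i) μ is a Mather measure; (ii) ∫ L dμ = 0 and μ is locally closed, i.e. ∫ Dψ(x)·q dμ(x,q) = 0 for every compactly supported C¹ function ψ : ℝ^N → ℝ; (iii) ∫ L dμ = 0 and every continuous Φ : ℝ^N × ℝ^N → ℝ admitting a subsolution is μ-integrable with ∫ Φ dμ ≥ 0. -/
open MeasureTheory Set
open scoped RealInnerProductSpace

noncomputable section

open Filter Topology Metric

section Mollification

variable {E : Type*} [NormedAddCommGroup E] [InnerProductSpace ℝ E] [FiniteDimensional ℝ E]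
  [MeasurableSpace E] [BorelSpace E]

/-- A globally Lipschitz function has `C¹` mollifications whose derivative at `x` lies in every
closed convex set containing almost all derivatives of the function near `x`. -/
lemma LipschitzWith.exists_contDiff_fderiv_mem {w : E → ℝ} {K : NNReal} (hw : LipschitzWith K w)
    {η : ℝ} (hη : 0 < η) :
    ∃ v : E → ℝ, ContDiff ℝ 1 v ∧ ∀ (x : E) (C : Set (E →L[ℝ] ℝ)), Convex ℝ C → IsClosed C →
      (∀ᵐ y : E, y ∈ ball x η → DifferentiableAt ℝ w y → fderiv ℝ w y ∈ C) →
      fderiv ℝ v x ∈ C := by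
  let φ : ContDiffBump (0 : E) := ⟨η / 2, η, by positivity, by linarith⟩
  let ρ : E → ℝ := φ.normed volume
  have hρ0 : ∀ y, 0 ≤ ρ y := φ.nonneg_normed
  have hρm : Measurable ρ := φ.continuous_normed.measurable
  let ν : Measure E := volume.withDensity fun y => ENNReal.ofReal (ρ y)
  have hν : IsProbabilityMeasure ν := by
    refine ⟨?_⟩
    rw [withDensity_apply _ MeasurableSet.univ, Measure.restrict_univ,
      ← ofReal_integral_eq_lintegral_ofReal φ.integrable_normed (ae_of_all _ hρ0),
      φ.integral_normed, ENNReal.ofReal_one]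
  have hνac : ν ≪ volume := withDensity_absolutelyContinuous _ _
  have hinteg : ∀ f : E → ℝ, ∫ y, f y ∂ν = ∫ y, ρ y * f y := by
    intro f
    rw [integral_withDensity_eq_integral_toReal_smul hρm.ennreal_ofReal
      (ae_of_all _ fun _ => ENNReal.ofReal_lt_top)]
    simp [ENNReal.toReal_ofReal (hρ0 _)]
  have hνball : ∀ᵐ y ∂ν, y ∈ ball (0 : E) η := by
    rw [ae_withDensity_iff hρm.ennreal_ofReal]
    refine ae_of_all _ fun y hy => ?_
    have : y ∈ Function.support ρ := by
      intro h
      simp [h] at hy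
    rwa [φ.support_normed_eq] at this
  have hshift : ∀ x : E, Measure.QuasiMeasurePreserving (fun y => x - y) (volume : Measure E) volume :=
    fun x => (Measure.measurePreserving_sub_left volume x).quasiMeasurePreserving
  refine ⟨fun x => ∫ y, w (x - y) ∂ν, ?_, ?_⟩
  · have := φ.hasCompactSupport_normed.contDiff_convolution_left (n := 1) (μ := volume)
      (ContinuousLinearMap.lsmul ℝ ℝ) (φ.contDiff_normed (μ := volume))
      hw.continuous.locallyIntegrable
    have heq : (fun x => ∫ y, w (x - y) ∂ν) =
        convolution ρ w (ContinuousLinearMap.lsmul ℝ ℝ) volume := by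
      funext x
      rw [hinteg, convolution_def]
      rfl
    rw [heq]
    exact_mod_cast this
  · intro x C hC hCc hmem
    have hdiff : ∀ᵐ y ∂ν, DifferentiableAt ℝ w (x - y) :=
      hνac.ae_le ((hshift x).ae hw.ae_differentiableAt)
    have key := hasFDerivAt_integral_of_dominated_loc_of_lip (μ := ν) (𝕜 := ℝ)
      (F := fun x y => w (x - y)) (F' := fun y => fderiv ℝ w (x - y)) (x₀ := x) (s := univ)
      (bound := fun _ => (K : ℝ)) univ_mem
      (Eventually.of_forall fun z =>
        (hw.continuous.comp (continuous_const.sub continuous_id)).aestronglyMeasurable)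
      (by
        have hb : ∀ᵐ y ∂ν, ‖w (x - y)‖ ≤ ‖w x‖ + K * η := by
          filter_upwards [hνball] with y hy
          have h1 := hw.dist_le_mul (x - y) x
          rw [dist_eq_norm, dist_eq_norm] at h1
          have h2 : ‖x - y - x‖ ≤ η := by
            simpa using (mem_ball_zero_iff.1 hy).le
          have h3 : (K : ℝ) * ‖x - y - x‖ ≤ K * η := by gcongr
          have h4 := norm_sub_norm_le (w (x - y)) (w x)
          linarith
        exact Integrable.of_bound
          (hw.continuous.comp (continuous_const.sub continuous_id)).aestronglyMeasurable _ hb)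
      ((measurable_fderiv ℝ w).comp (measurable_const.sub measurable_id)).aestronglyMeasurable
      (ae_of_all _ fun y => by
        have : LipschitzWith K fun z => w (z - y) := by
          simpa [Function.comp_def] using
            hw.comp ((LipschitzWith.id).sub (LipschitzWith.const y))
        simpa using this)
      (integrable_const _)
      (by
        filter_upwards [hdiff] with y hy
        simpa [Function.comp_def] using hy.hasFDerivAt.comp x ((hasFDerivAt_id x).sub_const y))
    rw [key.2.fderiv]
    refine hC.integral_mem hCc ?_ key.1
    filter_upwards [hdiff, hνball, hνac.ae_le ((hshift x).ae hmem)] with y h1 h2 h3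
    refine h3 ?_ h1
    simpa [dist_eq_norm] using h2

/-- A locally Lipschitz function can be approximated near a ball by `C¹` functions whose
derivatives obey slightly relaxed closed convex constraints. -/
lemma LocallyLipschitz.exists_contDiff_fderiv_mem {u : E → ℝ} (hu : LocallyLipschitz u) (R : ℝ)
    {η : ℝ} (hη : 0 < η) (C : E → Set (E →L[ℝ] ℝ)) (hC : ∀ x, Convex ℝ (C x))
    (hCc : ∀ x, IsClosed (C x))
    (h : ∀ᵐ y : E, ∀ x ∈ closedBall (0 : E) R, y ∈ ball x η → DifferentiableAt ℝ u y →
      fderiv ℝ u y ∈ C x) :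
    ∃ v : E → ℝ, ContDiff ℝ 1 v ∧ ∀ x ∈ closedBall (0 : E) R, fderiv ℝ v x ∈ C x := by
  obtain ⟨K, hK⟩ := (hu.locallyLipschitzOn (s := closedBall (0 : E) (R + η))
    ).exists_lipschitzOnWith_of_compact (isCompact_closedBall _ _)
  obtain ⟨w, hw, huw⟩ := hK.extend_real
  obtain ⟨v, hv, hvC⟩ := hw.exists_contDiff_fderiv_mem hη
  refine ⟨v, hv, fun x hx => hvC x (C x) (hC x) (hCc x) ?_⟩
  filter_upwards [h] with y hy hyx hwy
  have hsub : ball (0 : E) (R + η) ∈ 𝓝 y := by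
    refine isOpen_ball.mem_nhds ?_
    rw [mem_closedBall] at hx
    rw [mem_ball] at hyx ⊢
    linarith [dist_triangle y x 0]
  have heq : u =ᶠ[𝓝 y] w := by
    filter_upwards [hsub] with z hz using huw (ball_subset_closedBall hz)
  rw [← heq.fderiv_eq]
  exact hy x hx hyx (heq.differentiableAt_iff.2 hwy)

end Mollification

section Approximation

variable {N : ℕ}

/-- Uniform continuity of a continuous function under small shifts of the base point. -/
lemma Continuous.exists_le_add_of_dist_lt {F : Euc N × Euc N → ℝ} (hF : Continuous F) (R Q : ℝ)
    {δ : ℝ} (hδ : 0 < δ) :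
    ∃ η : ℝ, 0 < η ∧ η ≤ 1 ∧ ∀ x y p : Euc N, ‖x‖ ≤ R → dist y x < η → ‖p‖ ≤ Q →
      F (x, p) ≤ F (y, p) + δ := by
  have hK : IsCompact (closedBall (0 : Euc N) (R + 1) ×ˢ closedBall (0 : Euc N) Q) :=
    (isCompact_closedBall _ _).prod (isCompact_closedBall _ _)
  obtain ⟨η, hη, h⟩ := Metric.uniformContinuousOn_iff.1
    (hK.uniformContinuousOn_of_continuous hF.continuousOn) δ hδ
  refine ⟨min η 1, lt_min hη one_pos, min_le_right _ _, fun x y p hx hy hp => ?_⟩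
  have hy1 : dist y x < 1 := hy.trans_le (min_le_right _ _)
  have hyR : ‖y‖ ≤ R + 1 := by
    rw [dist_eq_norm] at hy1
    linarith [norm_le_norm_add_norm_sub' y x]
  have := h (x, p) ⟨by simpa using hx.trans (by linarith), by simpa using hp⟩
    (y, p) ⟨by simpa using hyR, by simpa using hp⟩
    (by simpa [Prod.dist_eq, dist_comm x y] using hy.trans_le (min_le_left _ _))
  rw [Real.dist_eq] at this
  linarith [(abs_lt.1 this).2]

/-- Subsolutions can be regularised on a ball at the price of a small increase of the level. -/
lemma IsSubsol.exists_contDiff {H : Euc N × Euc N → ℝ} (hA1 : Continuous H)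
    (hconv : ∀ x : Euc N, ConvexOn ℝ Set.univ fun p => H (x, p))
    (hcoer : ∀ R : ℝ, 0 < R → ∀ C : ℝ, ∃ r : ℝ, ∀ x p : Euc N,
      ‖x‖ ≤ R → r ≤ ‖p‖ → C ≤ H (x, p))
    {a : ℝ} {u : Euc N → ℝ} (hu : IsSubsol H a u) {R : ℝ} (hR : 0 ≤ R) {δ : ℝ} (hδ : 0 < δ) :
    ∃ v : Euc N → ℝ, ContDiff ℝ 1 v ∧ ∀ x, ‖x‖ ≤ R → H (x, gradient v x) ≤ a + δ := by
  obtain ⟨r, hr⟩ := hcoer (R + 1) (by linarith) (a + 1)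
  obtain ⟨η, hη, hη1, hH⟩ := hA1.exists_le_add_of_dist_lt R r hδ
  obtain ⟨v, hv, hvC⟩ := hu.1.exists_contDiff_fderiv_mem R hη
    (fun x => {l | H (x, (InnerProductSpace.toDual ℝ (Euc N)).symm l) ≤ a + δ})
    (fun x l hl k hk s t hs ht hst => by
      have h := (hconv x).2 (mem_univ ((InnerProductSpace.toDual ℝ (Euc N)).symm l))
        (mem_univ ((InnerProductSpace.toDual ℝ (Euc N)).symm k)) hs ht hst
      simp only [mem_ofPred_eq, smul_eq_mul] at h hl hk ⊢
      rw [map_add, map_smulₛₗ, map_smulₛₗ]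
      simp only [conj_trivial]
      refine h.trans ?_
      calc _ ≤ s * (a + δ) + t * (a + δ) := by gcongr
        _ = a + δ := by rw [← add_mul, hst, one_mul])
    (fun x => isClosed_le (by fun_prop) continuous_const)
    (by
      filter_upwards [hu.2] with y hy x hx hyx hdy
      have hHy := hy hdy
      have hxR : ‖x‖ ≤ R := by simpa using hx
      have hyR : ‖y‖ ≤ R + 1 := by
        rw [mem_ball, dist_eq_norm] at hyx
        linarith [norm_le_norm_add_norm_sub' y x]
      have hp : ‖gradient u y‖ ≤ r := by
        by_contra hcon
        linarith [hr y _ hyR (not_le.1 hcon).le]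
      exact (hH x y _ hxR hyx hp).trans (by linarith))
  exact ⟨v, hv, fun x hx => hvC x (by simpa using hx)⟩

/-- Subsolutions for a generalized Lagrangian can be regularised on bounded sets. -/
lemma SubsolFor.exists_contDiff {Φ : Euc N × Euc N → ℝ} (hΦ : Continuous Φ) {u : Euc N → ℝ}
    (hu : SubsolFor Φ u) (R Q : ℝ) {δ : ℝ} (hδ : 0 < δ) :
    ∃ v : Euc N → ℝ, ContDiff ℝ 1 v ∧
      ∀ x q, ‖x‖ ≤ R → ‖q‖ ≤ Q → fderiv ℝ v x q ≤ Φ (x, q) + δ := by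
  have hΦ' : Continuous fun z : Euc N × Euc N => - Φ z := hΦ.neg
  obtain ⟨η, hη, hη1, hH⟩ := hΦ'.exists_le_add_of_dist_lt R Q hδ
  obtain ⟨v, hv, hvC⟩ := hu.1.exists_contDiff_fderiv_mem R hη
    (fun x => {l | ∀ q, ‖q‖ ≤ Q → l q ≤ Φ (x, q) + δ})
    (fun x l hl k hk s t hs ht hst q hq => by
      simp only [add_apply, smul_apply, smul_eq_mul]
      calc _ ≤ s * (Φ (x, q) + δ) + t * (Φ (x, q) + δ) := by
            gcongr
            exacts [hl q hq, hk q hq]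
        _ = Φ (x, q) + δ := by rw [← add_mul, hst, one_mul])
    (fun x => by
      simp only [ofPred_forall]
      exact isClosed_iInter fun q => isClosed_iInter fun _ =>
        isClosed_le (by fun_prop) continuous_const)
    (by
      filter_upwards [hu.2] with y hy x hx hyx hdy q hq
      have h1 := hH x y q (by simpa using hx) hyx hq
      have h2 := hy hdy q
      linarith)
  exact ⟨v, hv, fun x q hx hq => hvC x (by simpa using hx) q hq⟩

end Approximation

section Lagrangian

variable {N : ℕ} {H : Euc N × Euc N → ℝ}

lemma inner_sub_le_Lag (hA1 : Continuous H)
    (hsl : ∀ x : Euc N, ∀ C : ℝ, ∃ r : ℝ, ∀ p : Euc N, r ≤ ‖p‖ → C * ‖p‖ ≤ H (x, p))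
    (x q p : Euc N) : ⟪p, q⟫ - H (x, p) ≤ Lag H (x, q) := by
  refine le_csSup ?_ ⟨p, rfl⟩
  obtain ⟨r, hr⟩ := hsl x ‖q‖
  obtain ⟨B, hB⟩ := (isCompact_closedBall (0 : Euc N) r).bddAbove_image
    (f := fun p : Euc N => ⟪p, q⟫ - H (x, p)) (by fun_prop)
  refine ⟨max B 0, ?_⟩
  rintro _ ⟨p', rfl⟩
  rcases le_total ‖p'‖ r with h | h
  · exact le_max_of_le_left (hB ⟨p', by simpa using h, rfl⟩)
  · refine le_max_of_le_right ?_
    have h1 := hr p' h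
    have h2 := real_inner_le_norm p' q
    have h3 := mul_comm ‖p'‖ ‖q‖
    simp only
    linarith

/-- The Lagrangian is superlinear in the velocity, locally uniformly in the base point. -/
lemma exists_mul_norm_sub_le_Lag (hA1 : Continuous H)
    (hsl : ∀ x : Euc N, ∀ C : ℝ, ∃ r : ℝ, ∀ p : Euc N, r ≤ ‖p‖ → C * ‖p‖ ≤ H (x, p))
    (R : ℝ) {K : ℝ} (hK : 0 ≤ K) :
    ∃ C : ℝ, ∀ x q : Euc N, ‖x‖ ≤ R → K * ‖q‖ - C ≤ Lag H (x, q) := by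
  obtain ⟨C, hC⟩ := ((isCompact_closedBall (0 : Euc N) R).prod
    (isCompact_closedBall (0 : Euc N) K)).bddAbove_image (f := H) hA1.continuousOn
  refine ⟨C, fun x q hx => ?_⟩
  have h := inner_sub_le_Lag hA1 hsl x q ((K * ‖q‖⁻¹) • q)
  have hnorm : ‖(K * ‖q‖⁻¹) • q‖ ≤ K := by
    rw [norm_smul, norm_mul, norm_inv, norm_norm, Real.norm_of_nonneg hK, mul_assoc]
    exact mul_le_of_le_one_right hK inv_mul_le_one
  have hHC : H (x, (K * ‖q‖⁻¹) • q) ≤ C :=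
    hC ⟨_, ⟨by simpa using hx, by simpa using hnorm⟩, rfl⟩
  have hin : ⟪(K * ‖q‖⁻¹) • q, q⟫ = K * ‖q‖ := by
    rw [real_inner_smul_left, real_inner_self_eq_norm_sq]
    rcases eq_or_ne ‖q‖ 0 with h0 | h0
    · simp [h0]
    · field_simp
  linarith

end Lagrangian

section Critical

variable {N : ℕ} {H : Euc N × Euc N → ℝ}

/-- A pointwise strict lower bound of the Hamiltonian is strictly below all subsolution levels. -/
lemma exists_lt_level (hA1 : Continuous H)
    (hconv : ∀ x : Euc N, ConvexOn ℝ Set.univ fun p => H (x, p))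
    (hcoer : ∀ R : ℝ, 0 < R → ∀ C : ℝ, ∃ r : ℝ, ∀ x p : Euc N,
      ‖x‖ ≤ R → r ≤ ‖p‖ → C ≤ H (x, p))
    {m : ℝ} {x₀ : Euc N} (hx₀ : ∀ p : Euc N, m < H (x₀, p)) :
    ∃ h₀ : ℝ, m < h₀ ∧ ∀ a u, IsSubsol H a u → h₀ ≤ a := by
  have hR : (0 : ℝ) < ‖x₀‖ + 1 := by positivity
  have htend : Tendsto (fun p : Euc N => H (x₀, p)) (cocompact (Euc N)) atTop := by
    refine tendsto_atTop.2 fun C => ?_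
    obtain ⟨r, hr⟩ := hcoer _ hR C
    filter_upwards [(tendsto_norm_cocompact_atTop (E := Euc N)).eventually_ge_atTop r] with p hp
    exact hr x₀ p (by linarith) hp
  obtain ⟨p₀, hp₀⟩ := Continuous.exists_forall_le
    (show Continuous fun p : Euc N => H (x₀, p) by fun_prop) htend
  refine ⟨H (x₀, p₀), hx₀ p₀, fun a u hu => le_of_forall_pos_le_add fun δ hδ => ?_⟩
  obtain ⟨v, -, hv⟩ := hu.exists_contDiff hA1 hconv hcoer (norm_nonneg x₀) hδ
  exact (hp₀ _).trans (hv x₀ le_rfl)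

/-- If the Hamiltonian at zero momentum is bounded at infinity, constants are subsolutions at some
level. -/
lemma exists_isSubsol_zero (hA1 : Continuous H) {m R : ℝ}
    (hout : ∀ x : Euc N, R ≤ ‖x‖ → H (x, 0) ≤ m) :
    ∃ a, IsSubsol H a fun _ => 0 := by
  obtain ⟨B, hB⟩ := (isCompact_closedBall (0 : Euc N) R).bddAbove_image
    (f := fun x : Euc N => H (x, 0)) (by fun_prop)
  refine ⟨max B m, (LipschitzWith.const (0 : ℝ)).locallyLipschitz, ae_of_all _ fun x _ => ?_⟩
  have hg : gradient (fun _ : Euc N => (0 : ℝ)) x = 0 := by simp [gradient]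
  rw [hg]
  rcases le_total ‖x‖ R with h | h
  · exact le_max_of_le_left (hB ⟨x, by simpa using h, rfl⟩)
  · exact le_max_of_le_right (hout x h)

end Critical

section Clamping

/-- A `C¹` regularisation of `s ↦ min s 0`, together with its derivative. -/
lemma exists_contDiff_min_zero : ∃ g θ : ℝ → ℝ, ContDiff ℝ 1 g ∧ (∀ s, HasDerivAt g (θ s) s) ∧
    (∀ s, 0 ≤ θ s) ∧ (∀ s, θ s ≤ 1) ∧ (∀ s, s ≤ -1 → θ s = 1) ∧ (∀ s, 0 ≤ s → θ s = 0) ∧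
    (∀ s, 0 ≤ s → g s = 0) ∧ (∀ s, g s ≤ 0) ∧ ∀ s, s ≤ 0 → s ≤ g s := by
  let θ : ℝ → ℝ := fun t => max 0 (min 1 (-t))
  have hθ : Continuous θ := by fun_prop
  have hθ0 : ∀ s, 0 ≤ θ s := fun s => le_max_left _ _
  have hθ1 : ∀ s, θ s ≤ 1 := fun s => max_le zero_le_one (min_le_left _ _)
  have hθz : ∀ s, 0 ≤ s → θ s = 0 := fun s hs =>
    max_eq_left ((min_le_right _ _).trans (by linarith))
  have hd : ∀ s, HasDerivAt (fun s => ∫ t in (0 : ℝ)..s, θ t) (θ s) s := fun s =>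
    intervalIntegral.integral_hasDerivAt_right (hθ.intervalIntegrable _ _)
      (hθ.stronglyMeasurableAtFilter _ _) hθ.continuousAt
  have hz : ∀ s, 0 ≤ s → ∫ t in (0 : ℝ)..s, θ t = 0 := fun s hs => by
    rw [intervalIntegral.integral_congr (g := fun _ => 0)]
    · simp
    · intro t ht
      rw [uIcc_of_le hs] at ht
      exact hθz t ht.1
  refine ⟨fun s => ∫ t in (0 : ℝ)..s, θ t, θ, ?_, hd, hθ0, hθ1, ?_, hθz, hz, ?_, ?_⟩
  · refine contDiff_one_iff_deriv.2 ⟨fun s => (hd s).differentiableAt, ?_⟩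
    rwa [show deriv (fun s => ∫ t in (0 : ℝ)..s, θ t) = θ from funext fun s => (hd s).deriv]
  · intro s hs
    simp only [θ]
    rw [min_eq_left (by linarith), max_eq_right zero_le_one]
  · intro s
    rcases le_total 0 s with hs | hs
    · exact (hz s hs).le
    · simp only
      rw [intervalIntegral.integral_symm]
      exact neg_nonpos.2 (intervalIntegral.integral_nonneg hs fun t _ => hθ0 t)
  · intro s hs
    simp only
    rw [intervalIntegral.integral_symm, le_neg]
    calc ∫ t in s..0, θ t ≤ ∫ _ in s..0, (1 : ℝ) :=
          intervalIntegral.integral_mono_on hs (hθ.intervalIntegrable _ _)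
            (continuous_const.intervalIntegrable _ _) fun t _ => hθ1 t
      _ = -s := by simp

variable {N : ℕ}

/-- Plateau functions with small gradient. -/
lemma exists_plateau {R B ε : ℝ} (hR : 0 < R) (hB : 0 < B) (hε : 0 < ε) :
    ∃ T : ℝ, ∃ b : Euc N → ℝ, ContDiff ℝ 1 b ∧ (∀ x, ‖x‖ ≤ R → b x = B) ∧
      (∀ x, T ≤ ‖x‖ → b x = 0) ∧ ∀ x, ‖gradient b x‖ ≤ ε := by
  let φ : ContDiffBump (0 : Euc N) := ⟨1, 2, one_pos, one_lt_two⟩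
  have hφ : ContDiff ℝ 1 φ := φ.contDiff
  obtain ⟨C, hC⟩ := (hφ.continuous_fderiv one_ne_zero).bounded_above_of_compact_support
    (φ.hasCompactSupport.fderiv ℝ)
  have hC0 : 0 ≤ C := (norm_nonneg _).trans (hC 0)
  set T := R + B * C / ε with hT
  have hTpos : 0 < T := by positivity
  have hder : ∀ x, HasFDerivAt (fun x => B * φ (T⁻¹ • x))
      (B • (fderiv ℝ φ (T⁻¹ • x)).comp (T⁻¹ • ContinuousLinearMap.id ℝ (Euc N))) x := by
    intro x
    have h1 := (hφ.differentiable one_ne_zero (T⁻¹ • x)).hasFDerivAt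
    have h2 : HasFDerivAt (fun x : Euc N => T⁻¹ • x) (T⁻¹ • ContinuousLinearMap.id ℝ (Euc N)) x :=
      (hasFDerivAt_id x).const_smul T⁻¹
    exact (h1.comp x h2).const_mul B
  refine ⟨2 * T, fun x => B * φ (T⁻¹ • x),
    contDiff_const.mul (hφ.comp (contDiff_const_smul T⁻¹)), ?_, ?_, ?_⟩
  · intro x hx
    have : φ (T⁻¹ • x) = 1 := by
      refine φ.one_of_mem_closedBall ?_
      rw [mem_closedBall_zero_iff, norm_smul, norm_inv, Real.norm_of_nonneg hTpos.le]
      change T⁻¹ * ‖x‖ ≤ 1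
      rw [inv_mul_le_iff₀ hTpos, mul_one]
      exact hx.trans (le_add_of_nonneg_right (by positivity))
    simp [this]
  · intro x hx
    have : φ (T⁻¹ • x) = 0 := by
      refine φ.zero_of_le_dist ?_
      rw [dist_zero_right, norm_smul, norm_inv, Real.norm_of_nonneg hTpos.le]
      change 2 ≤ T⁻¹ * ‖x‖
      rw [le_inv_mul_iff₀ hTpos]
      linarith
    simp [this]
  · intro x
    rw [gradient, LinearIsometryEquiv.norm_map, (hder x).fderiv,
      ContinuousLinearMap.comp_smul, ContinuousLinearMap.comp_id, norm_smul, norm_smul, norm_inv,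
      Real.norm_of_nonneg hB.le, Real.norm_of_nonneg hTpos.le]
    calc B * (T⁻¹ * ‖fderiv ℝ φ (T⁻¹ • x)‖) ≤ B * (T⁻¹ * C) := by gcongr; exact hC _
      _ = B * C / T := by ring
      _ ≤ ε := by
        rw [div_le_iff₀ hTpos, hT, mul_add, mul_div_cancel₀ _ hε.ne']
        nlinarith [mul_pos hε hR]

variable {H : Euc N × Euc N → ℝ}

lemma le_of_segment (hconv : ∀ x : Euc N, ConvexOn ℝ Set.univ fun p => H (x, p))
    {x p e : Euc N} {c t : ℝ} (hp : H (x, p) ≤ c) (he : H (x, e) ≤ c) (h0 : 0 ≤ t)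
    (h1 : t ≤ 1) : H (x, e + t • (p - e)) ≤ c := by
  have h := (hconv x).2 (mem_univ p) (mem_univ e) h0 (sub_nonneg.2 h1) (by ring)
  have heq : e + t • (p - e) = t • p + (1 - t) • e := by module
  rw [heq]
  refine h.trans ?_
  simp only [smul_eq_mul]
  nlinarith [mul_le_mul_of_nonneg_left hp h0, mul_le_mul_of_nonneg_left he (sub_nonneg.2 h1)]

/-- Almost critical `C¹` subsolutions with compact support which are uniformly strict outside a
ball independent of the level. -/
lemma exists_compactSupport_subsol (hA1 : Continuous H)
    (hconv : ∀ x : Euc N, ConvexOn ℝ Set.univ fun p => H (x, p))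
    (hcoer : ∀ R : ℝ, 0 < R → ∀ C : ℝ, ∃ r : ℝ, ∀ x p : Euc N,
      ‖x‖ ≤ R → r ≤ ‖p‖ → C ≤ H (x, p))
    {m R ε : ℝ} (hm : m < 0) (hR : 0 < R) (hε : 0 < ε)
    (hout : ∀ x : Euc N, R ≤ ‖x‖ → ∀ p : Euc N, ‖p‖ ≤ ε → H (x, p) ≤ m)
    (hcrit : ∀ δ : ℝ, 0 < δ → ∃ a < δ, ∃ u, IsSubsol H a u) :
    ∃ T : ℝ, ∀ δ : ℝ, 0 < δ → δ ≤ 1 → ∃ ψ : Euc N → ℝ, ContDiff ℝ 1 ψ ∧ HasCompactSupport ψ ∧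
      (∀ x, H (x, gradient ψ x) ≤ δ) ∧ ∀ x, T ≤ ‖x‖ → H (x, gradient ψ x) ≤ m := by
  obtain ⟨r, hr⟩ := hcoer R hR 2
  set M := max r 0 * R with hM
  have hM0 : 0 ≤ M := by positivity
  obtain ⟨T, b, hb, hbR, hbT, hbε⟩ := exists_plateau (N := N) hR
    (show 0 < M + 1 by linarith) hε
  obtain ⟨g, θ, hg, hgθ, hθ0, hθ1, hθone, hθzero, hgzero, hgneg, hgs⟩ := exists_contDiff_min_zero
  refine ⟨max R T, fun δ hδ hδ1 => ?_⟩
  obtain ⟨a, haδ, u₀, hu₀⟩ := hcrit δ hδ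
  obtain ⟨v, hv, hvH⟩ := hu₀.exists_contDiff hA1 hconv hcoer (R := max R T)
    (hR.le.trans (le_max_left _ _)) (sub_pos.2 haδ)
  simp only [add_sub_cancel] at hvH
  set u : Euc N → ℝ := fun x => v x - v 0 with hu
  have huC : ContDiff ℝ 1 u := hv.sub contDiff_const
  have hgrad : ∀ x, gradient u x = gradient v x := fun x => by
    simp [gradient, hu, fderiv_sub_const]
  have huM : ∀ x, ‖x‖ ≤ R → |u x| ≤ M := by
    intro x hx
    have hbd : ∀ y ∈ closedBall (0 : Euc N) R, ‖fderiv ℝ v y‖ ≤ max r 0 := by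
      intro y hy
      have hyR : ‖y‖ ≤ R := by simpa using hy
      rw [← toDual_gradient, LinearIsometryEquiv.norm_map]
      refine le_max_of_le_left ?_
      by_contra hcon
      linarith [hr y _ hyR (not_le.1 hcon).le, hvH y (hyR.trans (le_max_left _ _))]
    have h := (convex_closedBall (0 : Euc N) R).norm_image_sub_le_of_norm_fderiv_le
      (fun y _ => hv.differentiable one_ne_zero y) hbd (mem_closedBall_self hR.le)
      (show x ∈ closedBall (0 : Euc N) R by simpa using hx)
    rw [sub_zero, Real.norm_eq_abs] at h
    exact h.trans (mul_le_mul_of_nonneg_left hx (le_max_right _ _))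
  set S : Euc N → ℝ := fun x => b x + g (u x - b x) with hS
  set ψ : Euc N → ℝ := fun x => -b x - g (-b x - S x) with hψ
  have hSC : ContDiff ℝ 1 S := hb.add (hg.comp (huC.sub hb))
  have hψC : ContDiff ℝ 1 ψ := hb.neg.sub (hg.comp (hb.neg.sub hSC))
  have hgS : ∀ x, gradient S x =
      gradient b x + θ (u x - b x) • (gradient u x - gradient b x) := by
    intro x
    have hb' := (hb.differentiable one_ne_zero x).hasFDerivAt
    have hu' := (huC.differentiable one_ne_zero x).hasFDerivAt
    have h := hb'.add ((hgθ (u x - b x)).comp_hasFDerivAt x (hu'.sub hb'))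
    have h' : fderiv ℝ S x = _ := h.fderiv
    simp [gradient, h']
  have hgψ : ∀ x, gradient ψ x =
      -gradient b x + θ (-b x - S x) • (gradient S x - -gradient b x) := by
    intro x
    have hb' := (hb.differentiable one_ne_zero x).hasFDerivAt
    have hS' := (hSC.differentiable one_ne_zero x).hasFDerivAt
    have h := hb'.neg.sub ((hgθ (-b x - S x)).comp_hasFDerivAt x (hb'.neg.sub hS'))
    have h' : fderiv ℝ ψ x = _ := h.fderiv
    simp only [gradient, h', map_sub, map_neg, map_smulₛₗ, conj_trivial]
    module
  have hzero : ∀ x, T ≤ ‖x‖ → 0 ≤ -b x - S x := by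
    intro x hx
    simp only [hS, hbT x hx]
    linarith [hgneg (u x - 0)]
  have hfar : ∀ x, max R T ≤ ‖x‖ → H (x, gradient ψ x) ≤ m := by
    intro x hx
    rw [hgψ, hθzero _ (hzero x ((le_max_right _ _).trans hx)), zero_smul, add_zero]
    exact hout x ((le_max_left _ _).trans hx) _ (by rw [norm_neg]; exact hbε x)
  refine ⟨ψ, hψC, ?_, ?_, hfar⟩
  · refine HasCompactSupport.of_support_subset_isCompact (isCompact_closedBall (0 : Euc N) T) ?_
    intro x hx
    rw [mem_closedBall_zero_iff]
    by_contra hcon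
    have hxT := (not_le.1 hcon).le
    refine hx ?_
    simp only [hψ]
    rw [hgzero _ (hzero x hxT), hbT x hxT]
    simp
  · intro x
    rcases le_total (max R T) ‖x‖ with hx | hx
    · exact (hfar x hx).trans (hm.le.trans hδ.le)
    have hux : H (x, gradient u x) ≤ δ := by
      rw [hgrad]
      exact hvH x hx
    rcases le_total ‖x‖ R with hxR | hxR
    · have hux' := abs_le.1 (huM x hxR)
      have hbx := hbR x hxR
      have h1 : u x - b x ≤ -1 := by linarith
      have h2 : -b x - S x ≤ -1 := by
        have := hgs (u x - b x) (by linarith)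
        simp only [hS]
        linarith
      have : gradient ψ x = gradient u x := by
        rw [hgψ, hθone _ h2, hgS, hθone _ h1]
        module
      rwa [this]
    · have hm' : ∀ p : Euc N, ‖p‖ ≤ ε → H (x, p) ≤ δ := fun p hp =>
        (hout x hxR p hp).trans (hm.le.trans hδ.le)
      rw [hgψ]
      refine le_of_segment hconv ?_ (hm' _ (by rw [norm_neg]; exact hbε x)) (hθ0 _) (hθ1 _)
      rw [hgS]
      exact le_of_segment hconv hux (hm' _ (hbε x)) (hθ0 _) (hθ1 _)

end Clamping

section ClosedMeasures

variable {N : ℕ} {H : Euc N × Euc N → ℝ} {μ : Measure (Euc N × Euc N)}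

/-- A measure is locally closed if it annihilates differentials of compactly supported
functions. -/
def LocallyClosed (μ : Measure (Euc N × Euc N)) : Prop :=
  ∀ ψ : Euc N → ℝ, ContDiff ℝ 1 ψ → HasCompactSupport ψ →
    Integrable (fun w : Euc N × Euc N => fderiv ℝ ψ w.1 w.2) μ ∧
      (∫ w : Euc N × Euc N, fderiv ℝ ψ w.1 w.2 ∂μ) = 0

lemma continuous_fderiv_apply_snd {ψ : Euc N → ℝ} (hψ : ContDiff ℝ 1 ψ) :
    Continuous fun w : Euc N × Euc N => fderiv ℝ ψ w.1 w.2 :=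
  ((hψ.continuous_fderiv one_ne_zero).comp continuous_fst).clm_apply continuous_snd

lemma integrable_fderiv_apply [IsFiniteMeasure μ] (hA1 : Continuous H)
    (hsl : ∀ x : Euc N, ∀ C : ℝ, ∃ r : ℝ, ∀ p : Euc N, r ≤ ‖p‖ → C * ‖p‖ ≤ H (x, p))
    (hL : Integrable (Lag H) μ) {ψ : Euc N → ℝ} (hψ : ContDiff ℝ 1 ψ)
    (hψc : HasCompactSupport ψ) :
    Integrable (fun w : Euc N × Euc N => fderiv ℝ ψ w.1 w.2) μ := by
  have hψ'c : HasCompactSupport (fderiv ℝ ψ) := hψc.fderiv ℝ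
  obtain ⟨D, hD⟩ := (hψ.continuous_fderiv one_ne_zero).bounded_above_of_compact_support hψ'c
  have hD0 : 0 ≤ D := (norm_nonneg _).trans (hD 0)
  obtain ⟨R, hR⟩ := hψ'c.isCompact.isBounded.exists_norm_le
  obtain ⟨C, hC⟩ := exists_mul_norm_sub_le_Lag hA1 hsl R zero_le_one
  refine ((hL.norm.add (integrable_const |C|)).const_mul D).mono'
    (continuous_fderiv_apply_snd hψ).aestronglyMeasurable (ae_of_all _ fun w => ?_)
  simp only [Pi.add_apply]
  by_cases hw : fderiv ℝ ψ w.1 = 0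
  · simp only [hw, zero_apply, norm_zero]
    positivity
  · have hx := hR w.1 (subset_tsupport _ hw)
    have h1 := hC w.1 w.2 hx
    have h2 : ‖w.2‖ ≤ ‖Lag H w‖ + |C| := by
      have := le_abs_self (Lag H w)
      rw [Real.norm_eq_abs]
      linarith [le_abs_self C]
    calc ‖fderiv ℝ ψ w.1 w.2‖ ≤ ‖fderiv ℝ ψ w.1‖ * ‖w.2‖ := ContinuousLinearMap.le_opNorm _ _
      _ ≤ D * (‖Lag H w‖ + |C|) := mul_le_mul (hD _) h2 (norm_nonneg _) hD0

/-- Nonnegativity against test functions bounded from below implies local closedness. -/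
lemma locallyClosed_of_nonneg [IsFiniteMeasure μ] (hA1 : Continuous H)
    (hsl : ∀ x : Euc N, ∀ C : ℝ, ∃ r : ℝ, ∀ p : Euc N, r ≤ ‖p‖ → C * ‖p‖ ≤ H (x, p))
    (hL : Integrable (Lag H) μ)
    (hΦ : ∀ Φ : Euc N × Euc N → ℝ, Continuous Φ → BddBelow (Set.range Φ) →
      (∃ u, SubsolFor Φ u) → (Integrable Φ μ → 0 ≤ ∫ z, Φ z ∂μ)) :
    LocallyClosed μ := by
  have hnonneg : ∀ ψ : Euc N → ℝ, ContDiff ℝ 1 ψ → HasCompactSupport ψ →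
      0 ≤ ∫ w : Euc N × Euc N, fderiv ℝ ψ w.1 w.2 ∂μ := by
    intro ψ hψ hψc
    have hinteg := integrable_fderiv_apply hA1 hsl hL hψ hψc
    have hcont := continuous_fderiv_apply_snd hψ
    have hbound : ∀ (k : ℕ) (t : ℝ), ‖max t (-(k : ℝ))‖ ≤ ‖t‖ := by
      intro k t
      rw [Real.norm_eq_abs, Real.norm_eq_abs]
      refine abs_le.2 ⟨(neg_abs_le t).trans (le_max_left _ _), max_le (le_abs_self t) ?_⟩
      exact (neg_nonpos.2 k.cast_nonneg).trans (abs_nonneg t)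
    have hlim : Tendsto (fun k : ℕ => ∫ w : Euc N × Euc N, max (fderiv ℝ ψ w.1 w.2) (-(k : ℝ)) ∂μ)
        atTop (𝓝 (∫ w : Euc N × Euc N, fderiv ℝ ψ w.1 w.2 ∂μ)) := by
      refine tendsto_integral_of_dominated_convergence _
        (fun k => (hcont.max continuous_const).aestronglyMeasurable) hinteg.norm
        (fun k => ae_of_all _ fun w => hbound k _) (ae_of_all _ fun w => ?_)
      obtain ⟨n, hn⟩ := exists_nat_ge (-(fderiv ℝ ψ w.1 w.2))
      refine tendsto_const_nhds.congr' ?_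
      filter_upwards [eventually_ge_atTop n] with k hk
      have : (n : ℝ) ≤ k := by exact_mod_cast hk
      rw [max_eq_left (by linarith)]
    refine ge_of_tendsto' hlim fun k => ?_
    refine hΦ _ (hcont.max continuous_const) ⟨-(k : ℝ), ?_⟩ ⟨ψ, hψ.locallyLipschitz, ?_⟩ ?_
    · rintro _ ⟨w, rfl⟩
      exact le_max_right _ _
    · exact ae_of_all _ fun x _ q => le_max_left _ _
    · exact hinteg.mono (hcont.max continuous_const).aestronglyMeasurable
        (ae_of_all _ fun w => hbound k _)
  intro ψ hψ hψc
  refine ⟨integrable_fderiv_apply hA1 hsl hL hψ hψc, le_antisymm ?_ (hnonneg ψ hψ hψc)⟩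
  have h := hnonneg (fun x => -ψ x) hψ.neg (hψc.comp_left neg_zero)
  have heq : ∀ w : Euc N × Euc N, fderiv ℝ (fun x => -ψ x) w.1 w.2 = -fderiv ℝ ψ w.1 w.2 := by
    intro w
    simp [fderiv_fun_neg]
  simp only [heq, integral_neg] at h
  linarith

/-- Minimizing locally closed measures are concentrated on a bounded set. -/
lemma LocallyClosed.exists_ae_norm_le [IsProbabilityMeasure μ] (hcl : LocallyClosed μ)
    (hA1 : Continuous H)
    (hcoer : ∀ R : ℝ, 0 < R → ∀ C : ℝ, ∃ r : ℝ, ∀ x p : Euc N,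
      ‖x‖ ≤ R → r ≤ ‖p‖ → C ≤ H (x, p))
    (hsl : ∀ x : Euc N, ∀ C : ℝ, ∃ r : ℝ, ∀ p : Euc N, r ≤ ‖p‖ → C * ‖p‖ ≤ H (x, p))
    {m : ℝ} (hm : m < 0) (hL : Integrable (Lag H) μ) (hL0 : ∫ w, Lag H w ∂μ = 0)
    (hsub : ∃ T : ℝ, ∀ δ : ℝ, 0 < δ → δ ≤ 1 → ∃ ψ : Euc N → ℝ, ContDiff ℝ 1 ψ ∧
      HasCompactSupport ψ ∧ (∀ x, H (x, gradient ψ x) ≤ δ) ∧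
      ∀ x, T ≤ ‖x‖ → H (x, gradient ψ x) ≤ m) :
    ∃ T Q : ℝ, ∀ᵐ w ∂μ, ‖w.1‖ ≤ T ∧ ‖w.2‖ ≤ Q := by
  obtain ⟨T, hT⟩ := hsub
  obtain ⟨r, hr⟩ := hcoer (max T 1) (by positivity) 2
  obtain ⟨C, hC⟩ := exists_mul_norm_sub_le_Lag hA1 hsl (max T 1)
    (show 0 ≤ max r 0 + 1 by positivity)
  refine ⟨max T 1, C + 1, ?_⟩
  set A : Set (Euc N × Euc N) := {w | ¬(‖w.1‖ ≤ max T 1 ∧ ‖w.2‖ ≤ C + 1)} with hA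
  have hAm : MeasurableSet A := by
    refine MeasurableSet.compl (IsClosed.measurableSet ?_)
    exact (isClosed_le continuous_fst.norm continuous_const).inter
      (isClosed_le continuous_snd.norm continuous_const)
  set κ := min (-m) 1 with hκ
  have hκ0 : 0 < κ := lt_min (by linarith) one_pos
  have hbound : ∀ δ : ℝ, 0 < δ → δ ≤ 1 → κ * μ.real A ≤ δ := by
    intro δ hδ hδ1
    obtain ⟨ψ, hψ, hψc, hψH, hψT⟩ := hT δ hδ hδ1
    obtain ⟨hinteg, hzero⟩ := hcl ψ hψ hψc
    have hle : ∀ w : Euc N × Euc N,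
        A.indicator (fun _ => κ) w ≤ Lag H w - fderiv ℝ ψ w.1 w.2 + δ := by
      rintro ⟨x, q⟩
      have hfen := inner_sub_le_Lag hA1 hsl x q (gradient ψ x)
      rw [inner_gradient_left] at hfen
      have hHx := hψH x
      by_cases hw : (x, q) ∈ A
      · rw [indicator_of_mem hw]
        rcases le_total (max T 1) ‖x‖ with hx | hx
        · have := hψT x ((le_max_left _ _).trans hx)
          have : κ ≤ -m := min_le_left _ _
          simp only
          linarith
        · have hq : C + 1 < ‖q‖ := by
            by_contra hcon
            exact hw ⟨hx, not_lt.1 hcon⟩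
          have hp : ‖fderiv ℝ ψ x‖ ≤ max r 0 := by
            rw [← toDual_gradient, LinearIsometryEquiv.norm_map]
            refine le_max_of_le_left ?_
            by_contra hcon
            linarith [hr x _ hx (not_le.1 hcon).le]
          have h1 : fderiv ℝ ψ x q ≤ max r 0 * ‖q‖ :=
            (le_abs_self _).trans ((fderiv ℝ ψ x).le_of_opNorm_le hp q)
          have h2 := hC x q hx
          have h3 : κ ≤ 1 := min_le_right _ _
          simp only
          linarith
      · rw [indicator_of_notMem hw]
        simp only
        linarith
    have hI := integral_mono ((integrable_const κ).indicator hAm)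
      ((hL.sub hinteg).add (integrable_const δ)) hle
    rw [integral_add' (hL.sub hinteg) (integrable_const δ), integral_sub' hL hinteg, hL0, hzero,
      integral_indicator_const _ hAm] at hI
    simpa [mul_comm] using hI
  have hμA : μ.real A = 0 := by
    refine le_antisymm ?_ measureReal_nonneg
    have : κ * μ.real A ≤ 0 := by
      refine le_of_forall_pos_le_add fun δ hδ => ?_
      rw [zero_add]
      exact (hbound (min δ 1) (lt_min hδ one_pos) (min_le_right _ _)).trans (min_le_left _ _)
    exact nonpos_of_mul_nonpos_right this hκ0
  exact (measureReal_eq_zero_iff).1 hμA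

/-- A locally closed measure concentrated on a bounded set is nonnegative on all continuous
functions admitting a subsolution. -/
lemma LocallyClosed.integral_nonneg [IsProbabilityMeasure μ] (hcl : LocallyClosed μ) {T Q : ℝ}
    (hTQ : ∀ᵐ w ∂μ, ‖w.1‖ ≤ T ∧ ‖w.2‖ ≤ Q) {Φ : Euc N × Euc N → ℝ} (hΦ : Continuous Φ)
    {u : Euc N → ℝ} (hu : SubsolFor Φ u) : Integrable Φ μ ∧ 0 ≤ ∫ w, Φ w ∂μ := by
  have hΦi : Integrable Φ μ := by
    obtain ⟨B, hB⟩ := ((isCompact_closedBall (0 : Euc N) T).prod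
      (isCompact_closedBall (0 : Euc N) Q)).exists_bound_of_continuousOn hΦ.continuousOn
    refine Integrable.of_bound hΦ.aestronglyMeasurable B ?_
    filter_upwards [hTQ] with w hw
    exact hB w ⟨by simpa using hw.1, by simpa using hw.2⟩
  refine ⟨hΦi, le_of_forall_pos_le_add fun δ hδ => ?_⟩
  obtain ⟨v, hv, hvΦ⟩ := hu.exists_contDiff hΦ T Q hδ
  let χ : ContDiffBump (0 : Euc N) :=
    ⟨|T| + 1, |T| + 2, by positivity, by linarith⟩
  obtain ⟨hinteg, hzero⟩ := hcl (fun x => χ x * v x) (χ.contDiff.mul hv) χ.hasCompactSupport.mul_right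
  have hmono : ∫ w : Euc N × Euc N, fderiv ℝ (fun x => χ x * v x) w.1 w.2 ∂μ ≤
      ∫ w, (Φ w + δ) ∂μ := by
    refine integral_mono_ae hinteg (hΦi.add (integrable_const δ)) ?_
    filter_upwards [hTQ] with w hw
    have heq : (fun x => χ x * v x) =ᶠ[𝓝 w.1] v := by
      have hmem : ball (0 : Euc N) (|T| + 1) ∈ 𝓝 w.1 := by
        refine isOpen_ball.mem_nhds ?_
        rw [mem_ball_zero_iff]
        linarith [hw.1, le_abs_self T]
      filter_upwards [hmem] with y hy
      rw [χ.one_of_mem_closedBall (ball_subset_closedBall hy), one_mul]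
    rw [heq.fderiv_eq]
    exact hvΦ w.1 w.2 hw.1 hw.2
  rw [hzero, integral_add hΦi (integrable_const δ)] at hmono
  simpa using hmono

end ClosedMeasures

theorem stmt15 {N : ℕ} (hN : 1 ≤ N) (H : Euc N × Euc N → ℝ)
    (hA1 : Continuous H)
    (hA2conv : ∀ x : Euc N, ConvexOn ℝ Set.univ fun p => H (x, p))
    (hA2coer : ∀ R : ℝ, 0 < R → ∀ C : ℝ, ∃ r : ℝ, ∀ x p : Euc N,
      ‖x‖ ≤ R → r ≤ ‖p‖ → C ≤ H (x, p))
    (hA3 : ∃ ε > (0 : ℝ), ∃ m : ℝ,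
      (∃ R : ℝ, ∀ x : Euc N, R ≤ ‖x‖ → ∀ p : Euc N, ‖p‖ ≤ ε → H (x, p) ≤ m) ∧
      (∃ x₀ : Euc N, ∀ p : Euc N, m < H (x₀, p)))
    (hcrit : sInf {a : ℝ | ∃ u : Euc N → ℝ, IsSubsol H a u} = 0)
    (hsl : ∀ x : Euc N, ∀ C : ℝ, ∃ r : ℝ, ∀ p : Euc N, r ≤ ‖p‖ → C * ‖p‖ ≤ H (x, p))
    (μ : Measure (Euc N × Euc N)) (hprob : IsProbabilityMeasure μ) :
    (MatherMeasure H μ ↔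
      (Integrable (Lag H) μ ∧ (∫ w, Lag H w ∂μ) = 0 ∧
        ∀ ψ : Euc N → ℝ, ContDiff ℝ 1 ψ → HasCompactSupport ψ →
          Integrable (fun w : Euc N × Euc N => fderiv ℝ ψ w.1 w.2) μ ∧
          (∫ w : Euc N × Euc N, fderiv ℝ ψ w.1 w.2 ∂μ) = 0)) ∧
    (MatherMeasure H μ ↔
      (Integrable (Lag H) μ ∧ (∫ w, Lag H w ∂μ) = 0 ∧
        ∀ Φ : Euc N × Euc N → ℝ, Continuous Φ → (∃ u : Euc N → ℝ, SubsolFor Φ u) →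
          Integrable Φ μ ∧ 0 ≤ ∫ w, Φ w ∂μ)) := by
  obtain ⟨ε, hε, m, ⟨R, hout⟩, x₀, hx₀⟩ := hA3
  obtain ⟨h₀, hmh₀, hlow⟩ := exists_lt_level hA1 hA2conv hA2coer hx₀
  obtain ⟨a₀, ha₀⟩ := exists_isSubsol_zero hA1 (m := m) (R := R)
    fun x hx => hout x hx 0 (by simpa using hε.le)
  have hne : {a : ℝ | ∃ u : Euc N → ℝ, IsSubsol H a u}.Nonempty := ⟨a₀, _, ha₀⟩
  have hm : m < 0 := by
    refine hmh₀.trans_le (hcrit ▸ le_csInf hne ?_)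
    rintro a ⟨u, hu⟩
    exact hlow a u hu
  have hlevel : ∀ δ : ℝ, 0 < δ → ∃ a < δ, ∃ u, IsSubsol H a u := by
    intro δ hδ
    obtain ⟨a, ⟨u, hu⟩, ha⟩ := exists_lt_of_csInf_lt hne (hcrit.trans_lt hδ)
    exact ⟨a, ha, u, hu⟩
  have hsub := exists_compactSupport_subsol hA1 hA2conv hA2coer hm
    (lt_max_of_lt_right one_pos : 0 < max R 1) hε
    (fun x hx => hout x ((le_max_left _ _).trans hx)) hlevel
  have h12 : MatherMeasure H μ → (Integrable (Lag H) μ ∧ (∫ w, Lag H w ∂μ) = 0 ∧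
      LocallyClosed μ) := by
    rintro ⟨-, hL, hL0, hΦ⟩
    exact ⟨hL, hL0, locallyClosed_of_nonneg hA1 hsl hL hΦ⟩
  have h23 : (Integrable (Lag H) μ ∧ (∫ w, Lag H w ∂μ) = 0 ∧ LocallyClosed μ) →
      (Integrable (Lag H) μ ∧ (∫ w, Lag H w ∂μ) = 0 ∧
        ∀ Φ : Euc N × Euc N → ℝ, Continuous Φ → (∃ u : Euc N → ℝ, SubsolFor Φ u) →
          Integrable Φ μ ∧ 0 ≤ ∫ w, Φ w ∂μ) := by
    rintro ⟨hL, hL0, hcl⟩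
    obtain ⟨T, Q, hTQ⟩ := hcl.exists_ae_norm_le hA1 hA2coer hsl hm hL hL0 hsub
    exact ⟨hL, hL0, fun Φ hΦ ⟨u, hu⟩ => hcl.integral_nonneg hTQ hΦ hu⟩
  have h31 : (Integrable (Lag H) μ ∧ (∫ w, Lag H w ∂μ) = 0 ∧
        ∀ Φ : Euc N × Euc N → ℝ, Continuous Φ → (∃ u : Euc N → ℝ, SubsolFor Φ u) →
          Integrable Φ μ ∧ 0 ≤ ∫ w, Φ w ∂μ) → MatherMeasure H μ :=
    fun ⟨hL, hL0, h⟩ => ⟨hprob, hL, hL0, fun Φ hΦ _ hu _ => (h Φ hΦ hu).2⟩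
  exact ⟨⟨h12, fun h => h31 (h23 h)⟩, ⟨fun h => h23 (h12 h), h31⟩⟩

end
end
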